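/- arXiv:2408.11159 — 2 statements merged into one kernel-verified Lean document; each statement's English description precedes it below -/
import Mathlib

section
/- Let 1 ≤ α ≤ 3/2, 0 < δ₀ ≤ 1, C₀ ≥ 1, let F ⊂ B_{ℝ³}(0,1) be a finite nonempty set with uniform measure μ satisfying μ(B_{ℝ³}(w,δ)) ≤ C₀·δ^α for all w ∈ ℝ³ and δ ≥ δ₀, let t ≥ 0 and e^t·δ₀ ≤ δ ≤ 1. Then there exist η₀ > 0 and C₁ ≥ 1 (absolute constants) such that for all 0 < η ≤ η₀ and all C ≥ C₁ the following holds. Let F_hm be the set of all w ∈ F such that |{r ∈ [1/2, 1] : m^δ(π_{t,r}(w)) ≥ C₀·e^{−t/10}·δ^{α−18η}}| ≥ C·δ^η. Then μ(F_hm) ≤ C·δ^η. -/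
open MeasureTheory Real Metric

noncomputable section

abbrev E3 := EuclideanSpace ℝ (Fin 3)
abbrev E2 := EuclideanSpace ℝ (Fin 2)

/-- The projection `π_{t,r} : ℝ³ → ℝ²`. -/
def piProj (t r : ℝ) (w : E3) : E2 :=
  (EuclideanSpace.equiv (Fin 2) ℝ).symm
    ![Real.exp t * (w 0 + r * w 1 + r ^ 2 / 2 * w 2), w 1 + r * w 2]

/-- The uniform (normalized counting) measure of a set `A` with respect to a finite set `F`. -/
def mass {V : Type*} (F : Finset V) (A : Set V) : ℝ :=
  (Nat.card ↥(A ∩ (F : Set V)) : ℝ) / F.card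

/-- `m^δ(π_{t,r}(w)) = μ {w' ∈ F : ‖π_{t,r}(w) − π_{t,r}(w')‖ ≤ δ}`. -/
def mDelta (F : Finset E3) (t r δ : ℝ) (w : E3) : ℝ :=
  mass F {w' | ‖piProj t r w - piProj t r w'‖ ≤ δ}

section Counting

variable {ι : Type*}

theorem real_sign_mul (x y : ℝ) : Real.sign (x * y) = Real.sign x * Real.sign y := by
  rcases lt_trichotomy x 0 with hx | rfl | hx
  · rcases lt_trichotomy y 0 with hy | rfl | hy
    · simp [Real.sign_of_neg, Real.sign_of_pos, hx, hy, mul_pos_of_neg_of_neg]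
    · simp
    · simp [Real.sign_of_neg, Real.sign_of_pos, hx, hy, mul_neg_of_neg_of_pos]
  · simp
  · rcases lt_trichotomy y 0 with hy | rfl | hy
    · simp [Real.sign_of_neg, Real.sign_of_pos, hx, hy, mul_neg_of_pos_of_neg]
    · simp
    · simp [Real.sign_of_pos, hx, hy]

theorem sign_mul_sign_le {a b x y s s' ε : ℝ} (ha : 1 ≤ a) (hb : 0 < b)
    (h : |a * x * s + b * y * s'| ≤ ε) :
    Real.sign x * Real.sign y ≤
      -(Real.sign s * Real.sign s') + if |x| * |s| ≤ ε then 2 else 0 := by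
  have hs : ∀ z : ℝ, Real.sign z = -1 ∨ Real.sign z = 0 ∨ Real.sign z = 1 := Real.sign_apply_eq
  split_ifs with hc
  · rcases hs x with h1 | h1 | h1 <;> rcases hs y with h2 | h2 | h2 <;>
      rcases hs s with h3 | h3 | h3 <;> rcases hs s' with h4 | h4 | h4 <;>
      rw [h1, h2, h3, h4] <;> norm_num
  · push Not at hc
    rw [← abs_mul] at hc
    obtain ⟨h1, h2⟩ := abs_le.mp h
    have e1 : a * x * s = a * (x * s) := by ring
    have e2 : b * y * s' = b * (y * s') := by ring
    rw [e1, e2] at h1 h2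
    have hxs : Real.sign x * Real.sign s = Real.sign (x * s) := by
      rw [real_sign_mul]
    have hys : Real.sign y * Real.sign s' = Real.sign (y * s') := by
      rw [real_sign_mul]
    have key : Real.sign (x * s) * Real.sign (y * s') = -1 := by
      rcases le_or_gt 0 (x * s) with hp | hp
      · rw [abs_of_nonneg hp] at hc
        have : 0 ≤ ε := (abs_nonneg _).trans h
        have h5 : y * s' < 0 := by
          by_contra! h6
          nlinarith [mul_nonneg hb.le h6]
        rw [Real.sign_of_pos (lt_of_le_of_lt this hc), Real.sign_of_neg h5]; norm_num
      · rw [abs_of_neg hp] at hc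
        have h5 : 0 < y * s' := by
          by_contra! h6
          nlinarith [mul_nonneg hb.le (neg_nonneg.2 h6)]
        rw [Real.sign_of_neg hp, Real.sign_of_pos h5]; norm_num
    rw [← hxs, ← hys] at key
    have hss : (Real.sign s * Real.sign s') ^ 2 = 1 := by
      have hx2 : ∀ z, Real.sign z ^ 2 ≤ 1 := fun z => by
        rcases hs z with h | h | h <;> rw [h] <;> norm_num
      have : (Real.sign x * Real.sign y) ^ 2 * (Real.sign s * Real.sign s') ^ 2 = 1 := by
        linear_combination (Real.sign x * Real.sign y * Real.sign s * Real.sign s' - 1) * key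
      have h7 : (Real.sign x * Real.sign y) ^ 2 ≤ 1 := by
        rw [mul_pow]; exact mul_le_one₀ (hx2 x) (sq_nonneg _) (hx2 y)
      have h8 : (Real.sign s * Real.sign s') ^ 2 ≤ 1 := by
        rw [mul_pow]; exact mul_le_one₀ (hx2 s) (sq_nonneg _) (hx2 s')
      nlinarith [sq_nonneg (Real.sign s * Real.sign s')]
    have : Real.sign x * Real.sign y = -(Real.sign s * Real.sign s') := by
      linear_combination (Real.sign s * Real.sign s') * key - Real.sign x * Real.sign y * hss
    linarith

theorem sum_sum_mul_bool (F : Finset ι) (p : ι → Bool) (p' : ι → Bool) (g : ι → ℝ) :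
    ∑ u ∈ F, ∑ v ∈ F, (if p u = p v ∧ p' u = p' v then g u * g v else 0) =
      ∑ a : Bool, ∑ b : Bool, (∑ u ∈ F, if p u = a ∧ p' u = b then g u else 0) ^ 2 := by
  simp_rw [sq, Finset.sum_mul_sum, Fintype.sum_bool, ← Finset.sum_add_distrib]
  refine Finset.sum_congr rfl fun u _ => Finset.sum_congr rfl fun v _ => ?_
  cases p u <;> cases p v <;> cases p' u <;> cases p' v <;> simp

theorem sum_neg_add_two_mul (F : Finset ι) (f b : ι → ι → ι → ι → ℝ) :
    ∑ u ∈ F, ∑ v ∈ F, ∑ w ∈ F, ∑ w' ∈ F, (-f u v w w' + 2 * b u w w' v) =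
      -(∑ w ∈ F, ∑ w' ∈ F, ∑ u ∈ F, ∑ v ∈ F, f u v w w') +
        2 * ∑ u ∈ F, ∑ w ∈ F, ∑ w' ∈ F, ∑ v ∈ F, b u w w' v := by
  have hf : ∑ u ∈ F, ∑ v ∈ F, ∑ w ∈ F, ∑ w' ∈ F, f u v w w' =
      ∑ w ∈ F, ∑ w' ∈ F, ∑ u ∈ F, ∑ v ∈ F, f u v w w' := by
    calc _ = ∑ u ∈ F, ∑ w ∈ F, ∑ w' ∈ F, ∑ v ∈ F, f u v w w' := by
          refine Finset.sum_congr rfl fun u _ => ?_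
          rw [Finset.sum_comm]
          refine Finset.sum_congr rfl fun w _ => ?_
          rw [Finset.sum_comm]
      _ = _ := by
          rw [Finset.sum_comm]
          refine Finset.sum_congr rfl fun w _ => ?_
          rw [Finset.sum_comm]
  have hb : ∑ u ∈ F, ∑ v ∈ F, ∑ w ∈ F, ∑ w' ∈ F, b u w w' v =
      ∑ u ∈ F, ∑ w ∈ F, ∑ w' ∈ F, ∑ v ∈ F, b u w w' v := by
    refine Finset.sum_congr rfl fun u _ => ?_
    rw [Finset.sum_comm]
    refine Finset.sum_congr rfl fun w _ => ?_
    rw [Finset.sum_comm]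
  rw [← hf, ← hb]
  simp only [Finset.sum_add_distrib, Finset.sum_neg_distrib, Finset.mul_sum]

theorem sq_sum_separated_le (F : Finset ι) (V : Finset (ι × ι)) (W ρ : ι → ι → ℝ) (ε m : ℝ)
    (hW : ∀ u w, 0 ≤ W u w)
    (hV : ∀ u ∈ F, ∀ w ∈ F, ∀ w' ∈ F, W u w ≠ 0 → W u w' ≠ 0 → (w, w') ∈ V)
    (hquad : ∀ u ∈ F, ∀ v ∈ F, ∀ w ∈ F, ∀ w' ∈ F,
      W u w ≠ 0 → W u w' ≠ 0 → W v w ≠ 0 → W v w' ≠ 0 →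
      ∃ a b : ℝ, 1 ≤ a ∧ 0 < b ∧
        |a * (ρ u w - ρ v w) * (ρ u w' - ρ u w) +
          b * (ρ u w' - ρ v w') * (ρ v w' - ρ v w)| ≤ ε) :
    (∑ u ∈ F, ∑ w ∈ F, ∑ w' ∈ F, if ρ u w < m ∧ m ≤ ρ u w' then W u w * W u w' else 0) ^ 2 ≤
      V.card * (2 * ∑ u ∈ F, ∑ w ∈ F, ∑ w' ∈ F, ∑ v ∈ F,
        if |ρ u w - ρ v w| * |ρ u w' - ρ u w| ≤ ε then
          W u w * W u w' * W v w * W v w' else 0) := by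
  classical
  set lab : ι → ι → Bool := fun u w => decide (ρ u w < m) with hlab
  set g : ι → ι → ι → ℝ := fun w w' u =>
    Real.sign (ρ u w' - ρ u w) * (W u w * W u w') with hg
  set Y : ι → ι → ℝ := fun w w' =>
    ∑ u ∈ F, if ρ u w < m ∧ m ≤ ρ u w' then W u w * W u w' else 0 with hY
  set bad : ι → ι → ι → ι → ℝ := fun u w w' v =>
    if |ρ u w - ρ v w| * |ρ u w' - ρ u w| ≤ ε then
          W u w * W u w' * W v w * W v w' else 0 with hbad
  -- positivity of a Gram sum
  have h0 : 0 ≤ ∑ u ∈ F, ∑ v ∈ F, (∑ w ∈ F, if lab u w = lab v w then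
      Real.sign (ρ u w - ρ v w) * (W u w * W v w) else 0) ^ 2 :=
    Finset.sum_nonneg fun _ _ => Finset.sum_nonneg fun _ _ => sq_nonneg _
  have h1 : ∑ u ∈ F, ∑ v ∈ F, (∑ w ∈ F, if lab u w = lab v w then
      Real.sign (ρ u w - ρ v w) * (W u w * W v w) else 0) ^ 2 ≤
      ∑ u ∈ F, ∑ v ∈ F, ∑ w ∈ F, ∑ w' ∈ F, (-(if lab u w = lab v w ∧ lab u w' = lab v w' then
        g w w' u * g w w' v else 0) + 2 * bad u w w' v) := by
    refine Finset.sum_le_sum fun u hu => Finset.sum_le_sum fun v hv => ?_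
    rw [sq, Finset.sum_mul_sum]
    refine Finset.sum_le_sum fun w hw => Finset.sum_le_sum fun w' hw' => ?_
    have hTn : 0 ≤ W u w * W u w' * W v w * W v w' :=
      mul_nonneg (mul_nonneg (mul_nonneg (hW _ _) (hW _ _)) (hW _ _)) (hW _ _)
    have hbn : 0 ≤ bad u w w' v := by
      simp only [hbad]; split_ifs <;> [exact hTn; exact le_rfl]
    by_cases hl : lab u w = lab v w ∧ lab u w' = lab v w'
    · rw [if_pos hl.1, if_pos hl.2, if_pos hl]
      by_cases hz : W u w ≠ 0 ∧ W u w' ≠ 0 ∧ W v w ≠ 0 ∧ W v w' ≠ 0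
      · obtain ⟨a, b, ha, hb, hab⟩ := hquad u hu v hv w hw w' hw' hz.1 hz.2.1 hz.2.2.1 hz.2.2.2
        have := mul_le_mul_of_nonneg_right (sign_mul_sign_le ha hb hab) hTn
        simp only [hg, hbad]
        split_ifs at this ⊢ <;> linarith
      · have hT0 : W u w * W u w' * W v w * W v w' = 0 := by
          by_contra hne
          simp only [mul_ne_zero_iff] at hne
          exact hz ⟨hne.1.1.1, hne.1.1.2, hne.1.2, hne.2⟩
        have e1 : Real.sign (ρ u w - ρ v w) * (W u w * W v w) *
            (Real.sign (ρ u w' - ρ v w') * (W u w' * W v w')) = 0 := by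
          rw [show Real.sign (ρ u w - ρ v w) * (W u w * W v w) *
            (Real.sign (ρ u w' - ρ v w') * (W u w' * W v w')) =
            Real.sign (ρ u w - ρ v w) * Real.sign (ρ u w' - ρ v w') *
            (W u w * W u w' * W v w * W v w') by ring, hT0, mul_zero]
        have e2 : g w w' u * g w w' v = 0 := by
          simp only [hg]
          rw [show Real.sign (ρ u w' - ρ u w) * (W u w * W u w') *
            (Real.sign (ρ v w' - ρ v w) * (W v w * W v w')) =
            Real.sign (ρ u w' - ρ u w) * Real.sign (ρ v w' - ρ v w) *
            (W u w * W u w' * W v w * W v w') by ring, hT0, mul_zero]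
        rw [e1, e2]; linarith
    · rw [if_neg hl]
      have : (if lab u w = lab v w then Real.sign (ρ u w - ρ v w) * (W u w * W v w) else 0) *
          (if lab u w' = lab v w' then Real.sign (ρ u w' - ρ v w') * (W u w' * W v w') else 0)
          = 0 := by
        rw [not_and_or] at hl
        rcases hl with hl | hl <;> simp [hl]
      rw [this]; linarith
  have h2 : ∑ u ∈ F, ∑ v ∈ F, ∑ w ∈ F, ∑ w' ∈ F,
      (-(if lab u w = lab v w ∧ lab u w' = lab v w' then
        g w w' u * g w w' v else 0) + 2 * bad u w w' v) =
      -(∑ w ∈ F, ∑ w' ∈ F, ∑ u ∈ F, ∑ v ∈ F, if lab u w = lab v w ∧ lab u w' = lab v w' then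
        g w w' u * g w w' v else 0) + 2 * ∑ u ∈ F, ∑ w ∈ F, ∑ w' ∈ F, ∑ v ∈ F, bad u w w' v :=
    sum_neg_add_two_mul F (fun u v w w' => if lab u w = lab v w ∧ lab u w' = lab v w' then
        g w w' u * g w w' v else 0) bad
  have h3 : ∑ w ∈ F, ∑ w' ∈ F, (Y w w') ^ 2 ≤
      ∑ w ∈ F, ∑ w' ∈ F, ∑ u ∈ F, ∑ v ∈ F, if lab u w = lab v w ∧ lab u w' = lab v w' then
        g w w' u * g w w' v else 0 := by
    refine Finset.sum_le_sum fun w _ => Finset.sum_le_sum fun w' _ => ?_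
    rw [sum_sum_mul_bool F (fun u => lab u w) (fun u => lab u w') (g w w')]
    have : Y w w' = ∑ u ∈ F, if lab u w = true ∧ lab u w' = false then g w w' u else 0 := by
      refine Finset.sum_congr rfl fun u _ => ?_
      simp only [hlab, decide_eq_true_eq, decide_eq_false_iff_not, not_lt]
      split_ifs with h
      · simp only [hg]
        rw [Real.sign_of_pos (by linarith [h.1, h.2]), one_mul]
      · rfl
    rw [this, Fintype.sum_bool, Fintype.sum_bool, Fintype.sum_bool]
    linarith [sq_nonneg (∑ u ∈ F, if lab u w = true ∧ lab u w' = true then g w w' u else 0),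
      sq_nonneg (∑ u ∈ F, if lab u w = false ∧ lab u w' = true then g w w' u else 0),
      sq_nonneg (∑ u ∈ F, if lab u w = false ∧ lab u w' = false then g w w' u else 0)]
  have h4 : ∑ u ∈ F, ∑ w ∈ F, ∑ w' ∈ F,
      (if ρ u w < m ∧ m ≤ ρ u w' then W u w * W u w' else 0) =
      ∑ x ∈ (F ×ˢ F) ∩ V, Y x.1 x.2 := by
    have : ∑ u ∈ F, ∑ w ∈ F, ∑ w' ∈ F,
      (if ρ u w < m ∧ m ≤ ρ u w' then W u w * W u w' else 0) = ∑ x ∈ F ×ˢ F, Y x.1 x.2 := by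
      rw [Finset.sum_product, Finset.sum_comm]
      refine Finset.sum_congr rfl fun w _ => ?_
      rw [Finset.sum_comm]
    rw [this]
    symm
    apply Finset.sum_subset Finset.inter_subset_left
    intro x hx hxV
    simp only [Finset.mem_inter, hx, true_and] at hxV
    rw [Finset.mem_product] at hx
    refine Finset.sum_eq_zero fun u hu => ?_
    split_ifs
    · by_contra hne
      exact hxV (hV u hu _ hx.1 _ hx.2 (left_ne_zero_of_mul hne) (right_ne_zero_of_mul hne))
    · rfl
  rw [h4]
  have h5 := sq_sum_le_card_mul_sum_sq (s := (F ×ˢ F) ∩ V) (f := fun x => Y x.1 x.2)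
  have h6 : ∑ x ∈ (F ×ˢ F) ∩ V, (Y x.1 x.2) ^ 2 ≤ ∑ w ∈ F, ∑ w' ∈ F, (Y w w') ^ 2 := by
    rw [← Finset.sum_product']
    exact Finset.sum_le_sum_of_subset_of_nonneg Finset.inter_subset_left
      fun _ _ _ => sq_nonneg _
  have h7 : (((F ×ˢ F) ∩ V).card : ℝ) ≤ V.card := by
    exact_mod_cast Finset.card_le_card Finset.inter_subset_right
  refine h5.trans (mul_le_mul h7 ?_ (Finset.sum_nonneg fun _ _ => sq_nonneg _) (Nat.cast_nonneg _))
  linarith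

theorem exists_dyadic_cover {x y ε : ℝ} {L : ℕ} (hε : 0 < ε) (hx : x ≤ 1) (hy : y ≤ 1)
    (hxy : x * y ≤ ε) (hL : 1 < 2 ^ (L + 1) * ε) :
    ∃ k ∈ Finset.range (L + 1), x ≤ (2 ^ k)⁻¹ ∧ y ≤ 2 ^ (k + 1) * ε := by
  have H : ∀ n : ℕ, x ≤ (2 ^ n)⁻¹ ∨ ∃ k ∈ Finset.range n, x ≤ (2 ^ k)⁻¹ ∧ y ≤ 2 ^ (k + 1) * ε := by
    intro n
    induction n with
    | zero => left; simpa using hx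
    | succ n ih =>
      rcases ih with ih | ⟨k, hk, h⟩
      · by_cases hxn : x ≤ (2 ^ (n + 1))⁻¹
        · exact Or.inl hxn
        · right
          refine ⟨n, by simp, ih, ?_⟩
          push Not at hxn
          have h2 : (0 : ℝ) < 2 ^ (n + 1) := by positivity
          have hxp : 0 < x := lt_trans (by positivity) hxn
          rw [inv_lt_iff_one_lt_mul₀ h2] at hxn
          by_contra! hcon
          have : x * (2 ^ (n + 1) * ε) < x * y := mul_lt_mul_of_pos_left hcon hxp
          nlinarith
      · exact Or.inr ⟨k, by simp at hk ⊢; omega, h⟩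
  rcases H L with h | ⟨k, hk, h⟩
  · exact ⟨L, by simp, h, by linarith⟩
  · exact ⟨k, by simp at hk ⊢; omega, h⟩

theorem sum_bad_le (F : Finset ι) (W ρ : ι → ι → ℝ) {A B ε : ℝ} {L : ℕ}
    (hW : ∀ u w, 0 ≤ W u w) (hA : 0 ≤ A) (hB0 : 0 ≤ B) (hε : 0 < ε) (hε1 : ε ≤ 1)
    (hL1 : 2 ^ L * ε ≤ 1) (hL2 : 1 < 2 ^ (L + 1) * ε)
    (hB : ∀ u ∈ F, ∀ w ∈ F, W u w ≤ B)
    (hρ : ∀ u ∈ F, ∀ w ∈ F, W u w ≠ 0 → |ρ u w - 3 / 4| ≤ 1 / 2)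
    (hreg : ∀ u ∈ F, ∀ x h : ℝ, 0 ≤ h →
      ∑ w ∈ F, (if |ρ u w - x| ≤ h then W u w else 0) ≤ A * (h + ε))
    (hreg' : ∀ w ∈ F, ∀ x h : ℝ, 0 ≤ h →
      ∑ u ∈ F, (if |ρ u w - x| ≤ h then W u w else 0) ≤ A * (h + ε)) :
    ∑ u ∈ F, ∑ w ∈ F, ∑ w' ∈ F, ∑ v ∈ F,
        (if |ρ u w - ρ v w| * |ρ u w' - ρ u w| ≤ ε then
          W u w * W u w' * W v w * W v w' else 0) ≤
      F.card * (2 * A) * ((L + 1) * (6 * A ^ 2 * ε)) * B := by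
  have htot : ∀ u ∈ F, ∑ w ∈ F, W u w ≤ 2 * A := by
    intro u hu
    calc ∑ w ∈ F, W u w ≤ ∑ w ∈ F, (if |ρ u w - 3 / 4| ≤ 1 / 2 then W u w else 0) := by
          refine Finset.sum_le_sum fun w hw => ?_
          split_ifs with h
          · exact le_rfl
          · by_contra! hc
            exact h (hρ u hu w hw hc.ne')
      _ ≤ A * (1 / 2 + ε) := hreg u hu _ _ (by norm_num)
      _ ≤ 2 * A := by nlinarith
  have hin : ∀ u ∈ F, ∀ w ∈ F, ∑ w' ∈ F, ∑ v ∈ F,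
        (if |ρ u w - ρ v w| * |ρ u w' - ρ u w| ≤ ε then
          W u w * W u w' * W v w * W v w' else 0) ≤
        W u w * (((L + 1) * (6 * A ^ 2 * ε)) * B) := by
    intro u hu w hw
    have hpt : ∀ w' ∈ F, ∀ v ∈ F, (if |ρ u w - ρ v w| * |ρ u w' - ρ u w| ≤ ε then
          W u w * W u w' * W v w * W v w' else 0) ≤ ∑ k ∈ Finset.range (L + 1),
          W u w * B * ((if |ρ u w' - ρ u w| ≤ 2 ^ (k + 1) * ε then W u w' else 0) *
            (if |ρ v w - ρ u w| ≤ (2 ^ k)⁻¹ then W v w else 0)) := by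
      intro w' hw' v hv
      have hn : ∀ k ∈ Finset.range (L + 1),
          0 ≤ W u w * B * ((if |ρ u w' - ρ u w| ≤ 2 ^ (k + 1) * ε then W u w' else 0) *
            (if |ρ v w - ρ u w| ≤ (2 ^ k)⁻¹ then W v w else 0)) := by
        intro k _
        refine mul_nonneg (mul_nonneg (hW _ _) hB0) (mul_nonneg ?_ ?_) <;>
          split_ifs <;> first | exact hW _ _ | exact le_rfl
      split_ifs with hc
      · by_cases hz : W u w ≠ 0 ∧ W u w' ≠ 0 ∧ W v w ≠ 0
        · have a1 := abs_le.mp (hρ u hu w hw hz.1)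
          have a2 := abs_le.mp (hρ u hu w' hw' hz.2.1)
          have a3 := abs_le.mp (hρ v hv w hw hz.2.2)
          obtain ⟨k, hk, h1, h2⟩ := exists_dyadic_cover hε (x := |ρ u w - ρ v w|)
            (y := |ρ u w' - ρ u w|) (L := L) (abs_le.2 ⟨by linarith, by linarith⟩)
            (abs_le.2 ⟨by linarith, by linarith⟩) hc hL2
          refine le_trans ?_ (Finset.single_le_sum hn hk)
          rw [abs_sub_comm] at h1
          rw [if_pos h1, if_pos h2]
          have := mul_le_mul_of_nonneg_left (hB v hv w' hw')
            (mul_nonneg (mul_nonneg (hW u w) (hW u w')) (hW v w))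
          linarith
        · have : W u w * W u w' * W v w * W v w' = 0 := by
            by_contra hne
            simp only [mul_ne_zero_iff] at hne
            exact hz ⟨hne.1.1.1, hne.1.1.2, hne.1.2⟩
          rw [this]; exact Finset.sum_nonneg hn
      · exact Finset.sum_nonneg hn
    have hk : ∀ k ∈ Finset.range (L + 1), ∑ w' ∈ F, ∑ v ∈ F,
        ((if |ρ u w' - ρ u w| ≤ 2 ^ (k + 1) * ε then W u w' else 0) *
            (if |ρ v w - ρ u w| ≤ (2 ^ k)⁻¹ then W v w else 0)) ≤ 6 * A ^ 2 * ε := by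
      intro k hk
      rw [← Finset.sum_mul_sum]
      have h1 := hreg u hu (ρ u w) (2 ^ (k + 1) * ε) (by positivity)
      have h2 := hreg' w hw (ρ u w) ((2 ^ k)⁻¹) (by positivity)
      have hkL : (2 : ℝ) ^ k ≤ 2 ^ L :=
        pow_le_pow_right₀ (by norm_num) (by simp at hk; omega)
      have hkε : 2 ^ k * ε ≤ 1 := (mul_le_mul_of_nonneg_right hkL hε.le).trans hL1
      have hk1 : ((2 : ℝ) ^ k)⁻¹ ≤ 1 := inv_le_one_of_one_le₀ (one_le_pow₀ (by norm_num))
      refine (mul_le_mul h1 h2 (Finset.sum_nonneg fun v _ => ?_) (by positivity)).trans ?_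
      · split_ifs
        · exact hW _ _
        · exact le_rfl
      · have h3 : (2 ^ (k + 1) * ε + ε) * ((2 ^ k)⁻¹ + ε) ≤ 6 * ε := by
          have e : (2 ^ (k + 1) * ε + ε) * (((2 : ℝ) ^ k)⁻¹ + ε) =
              2 * ε * (2 ^ k * (2 ^ k)⁻¹) + 2 * ε * (2 ^ k * ε) + ε * (2 ^ k)⁻¹ + ε * ε := by
            rw [pow_succ]; ring
          rw [e, mul_inv_cancel₀ (by positivity)]
          nlinarith
        calc A * (2 ^ (k + 1) * ε + ε) * (A * ((2 ^ k)⁻¹ + ε))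
            = A ^ 2 * ((2 ^ (k + 1) * ε + ε) * ((2 ^ k)⁻¹ + ε)) := by ring
          _ ≤ A ^ 2 * (6 * ε) := mul_le_mul_of_nonneg_left h3 (sq_nonneg _)
          _ = _ := by ring
    calc _ ≤ ∑ w' ∈ F, ∑ v ∈ F, ∑ k ∈ Finset.range (L + 1),
          W u w * B * ((if |ρ u w' - ρ u w| ≤ 2 ^ (k + 1) * ε then W u w' else 0) *
            (if |ρ v w - ρ u w| ≤ (2 ^ k)⁻¹ then W v w else 0)) :=
          Finset.sum_le_sum fun w' hw' => Finset.sum_le_sum fun v hv => hpt w' hw' v hv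
      _ = ∑ k ∈ Finset.range (L + 1), W u w * B * ∑ w' ∈ F, ∑ v ∈ F,
          ((if |ρ u w' - ρ u w| ≤ 2 ^ (k + 1) * ε then W u w' else 0) *
            (if |ρ v w - ρ u w| ≤ (2 ^ k)⁻¹ then W v w else 0)) := by
          simp_rw [Finset.mul_sum]
          rw [Finset.sum_comm]
          conv_rhs => rw [Finset.sum_comm]; enter [2, w']; rw [Finset.sum_comm]
          rw [Finset.sum_comm]
      _ ≤ ∑ k ∈ Finset.range (L + 1), W u w * B * (6 * A ^ 2 * ε) :=
          Finset.sum_le_sum fun k hk' =>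
            mul_le_mul_of_nonneg_left (hk k hk') (mul_nonneg (hW _ _) hB0)
      _ = _ := by
          rw [Finset.sum_const, Finset.card_range, nsmul_eq_mul]; push_cast; ring
  calc _ ≤ ∑ u ∈ F, ∑ w ∈ F, W u w * (((L + 1) * (6 * A ^ 2 * ε)) * B) :=
        Finset.sum_le_sum fun u hu => Finset.sum_le_sum fun w hw => hin u hu w hw
    _ ≤ ∑ u ∈ F, 2 * A * (((L + 1) * (6 * A ^ 2 * ε)) * B) := by
        refine Finset.sum_le_sum fun u hu => ?_
        rw [← Finset.sum_mul]
        exact mul_le_mul_of_nonneg_right (htot u hu) (by positivity)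
    _ = _ := by rw [Finset.sum_const, nsmul_eq_mul]; ring

theorem sq_le_sum_far (F : Finset ι) (W ρ : ι → ι → ℝ) {A ε q : ℝ}
    (hW : ∀ u w, 0 ≤ W u w) (hA : 0 < A) (hq : 0 ≤ q)
    (hreg : ∀ u ∈ F, ∀ x h : ℝ, 0 ≤ h →
      ∑ w ∈ F, (if |ρ u w - x| ≤ h then W u w else 0) ≤ A * (h + ε))
    (hqT : F.card * q ≤ ∑ u ∈ F, ∑ w ∈ F, W u w) (hlt : ε ≤ q / (4 * A)) :
    F.card * q ^ 2 / 4 ≤ ∑ u ∈ F, ∑ w ∈ F, ∑ w' ∈ F,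
      if q / (4 * A) < ρ u w' - ρ u w then W u w * W u w' else 0 := by
  set τ := q / (4 * A) with hτ
  have hτA : A * τ = q / 4 := by rw [hτ]; field_simp
  have hτ0 : 0 ≤ τ := by positivity
  have key : ∀ u ∈ F, 3 / 2 * q * (∑ w ∈ F, W u w) - q ^ 2 ≤
      2 * ∑ w ∈ F, ∑ w' ∈ F, if τ < ρ u w' - ρ u w then W u w * W u w' else 0 := by
    intro u hu
    set T := ∑ w ∈ F, W u w with hT
    have hT0 : 0 ≤ T := Finset.sum_nonneg fun w _ => hW u w
    have hnear : ∑ w ∈ F, ∑ w' ∈ F,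
        (if |ρ u w' - ρ u w| ≤ τ then W u w * W u w' else 0) ≤ T * (q / 2) := by
      rw [hT, Finset.sum_mul]
      refine Finset.sum_le_sum fun w hw => ?_
      have h1 := hreg u hu (ρ u w) τ hτ0
      have h2 : A * (τ + ε) ≤ q / 2 := by nlinarith
      calc _ = W u w * ∑ w' ∈ F, (if |ρ u w' - ρ u w| ≤ τ then W u w' else 0) := by
            rw [Finset.mul_sum]
            refine Finset.sum_congr rfl fun w' _ => ?_
            split_ifs <;> simp
        _ ≤ _ := mul_le_mul_of_nonneg_left (h1.trans h2) (hW u w)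
    have hsplit : T * T = ∑ w ∈ F, ∑ w' ∈ F,
        (if |ρ u w' - ρ u w| ≤ τ then W u w * W u w' else 0) +
        (∑ w ∈ F, ∑ w' ∈ F, (if τ < ρ u w' - ρ u w then W u w * W u w' else 0) +
        ∑ w ∈ F, ∑ w' ∈ F, (if τ < ρ u w - ρ u w' then W u w' * W u w else 0)) := by
      rw [hT, Finset.sum_mul_sum]
      simp only [← Finset.sum_add_distrib]
      refine Finset.sum_congr rfl fun w _ => Finset.sum_congr rfl fun w' _ => ?_
      by_cases h1 : τ < ρ u w' - ρ u w
      · have h2 : ¬ |ρ u w' - ρ u w| ≤ τ := by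
          rw [not_le]; exact h1.trans_le (le_abs_self _)
        have h3 : ¬ τ < ρ u w - ρ u w' := by intro h; linarith
        simp [h1, h2, h3]
      · by_cases h3 : τ < ρ u w - ρ u w'
        · have h2 : ¬ |ρ u w' - ρ u w| ≤ τ := by
            rw [not_le, abs_sub_comm]; exact h3.trans_le (le_abs_self _)
          simp [h1, h2, h3, mul_comm]
        · have h2 : |ρ u w' - ρ u w| ≤ τ := by rw [abs_le]; constructor <;> linarith
          simp [h1, h2, h3]
    have hsym : ∑ w ∈ F, ∑ w' ∈ F, (if τ < ρ u w - ρ u w' then W u w' * W u w else 0) =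
        ∑ w ∈ F, ∑ w' ∈ F, (if τ < ρ u w' - ρ u w then W u w * W u w' else 0) :=
      Finset.sum_comm
    rw [hsym] at hsplit
    nlinarith [sq_nonneg (T - q)]
  have hsum := Finset.sum_le_sum key
  rw [Finset.sum_sub_distrib, ← Finset.mul_sum, ← Finset.mul_sum] at hsum
  simp only [Finset.sum_const, nsmul_eq_mul] at hsum
  nlinarith [mul_le_mul_of_nonneg_left hqT hq]

theorem sum_far_le_sum_separated (F : Finset ι) (W ρ : ι → ι → ℝ) {τ : ℝ} (N : ℕ)
    (hW : ∀ u w, 0 ≤ W u w) (hτ : 0 < τ) (hN : 5 / (4 * τ) < N)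
    (hρ : ∀ u ∈ F, ∀ w ∈ F, W u w ≠ 0 → |ρ u w - 3 / 4| ≤ 1 / 2) :
    (∑ u ∈ F, ∑ w ∈ F, ∑ w' ∈ F,
      if τ < ρ u w' - ρ u w then W u w * W u w' else 0) ≤
    ∑ k ∈ Finset.range N, ∑ u ∈ F, ∑ w ∈ F, ∑ w' ∈ F,
      if ρ u w < k * τ ∧ k * τ ≤ ρ u w' then W u w * W u w' else 0 := by
  have hterm : ∀ (u w w' : ι) (m : ℝ),
      0 ≤ if ρ u w < m ∧ m ≤ ρ u w' then W u w * W u w' else 0 := by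
    intro u w w' m
    split_ifs
    · exact mul_nonneg (hW _ _) (hW _ _)
    · exact le_rfl
  have hcomm : (∑ k ∈ Finset.range N, ∑ u ∈ F, ∑ w ∈ F, ∑ w' ∈ F,
      if ρ u w < k * τ ∧ k * τ ≤ ρ u w' then W u w * W u w' else 0) =
      ∑ u ∈ F, ∑ w ∈ F, ∑ w' ∈ F, ∑ k ∈ Finset.range N,
      if ρ u w < k * τ ∧ k * τ ≤ ρ u w' then W u w * W u w' else 0 := by
    rw [Finset.sum_comm]
    refine Finset.sum_congr rfl fun u _ => ?_
    rw [Finset.sum_comm]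
    refine Finset.sum_congr rfl fun w _ => ?_
    rw [Finset.sum_comm]
  rw [hcomm]
  refine Finset.sum_le_sum fun u hu => Finset.sum_le_sum fun w hw =>
    Finset.sum_le_sum fun w' hw' => ?_
  by_cases hlt : τ < ρ u w' - ρ u w
  · rw [if_pos hlt]
    by_cases h1 : W u w = 0
    · simp [h1]
    by_cases h2 : W u w' = 0
    · simp [h2]
    have r1 := abs_le.1 (hρ u hu w hw h1)
    have r2 := abs_le.1 (hρ u hu w' hw' h2)
    set k := ⌊ρ u w / τ⌋₊ + 1 with hk
    have hk1 : ρ u w < k * τ := by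
      have := Nat.lt_floor_add_one (ρ u w / τ)
      rw [div_lt_iff₀ hτ] at this
      simpa [hk] using this
    have hk2 : k * τ ≤ ρ u w' := by
      have h0 : 0 ≤ ρ u w / τ := div_nonneg (by linarith) hτ.le
      have := Nat.floor_le h0
      rw [le_div_iff₀ hτ] at this
      have e : (k : ℝ) = ⌊ρ u w / τ⌋₊ + 1 := by simp [hk]
      rw [e]; linarith
    have hkN : k < N := by
      have : (k : ℝ) < N := by
        refine lt_of_le_of_lt ?_ hN
        rw [le_div_iff₀ (by positivity)]; linarith
      exact_mod_cast this
    refine le_trans (le_of_eq ?_) (Finset.single_le_sum (f := fun k : ℕ =>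
      if ρ u w < k * τ ∧ k * τ ≤ ρ u w' then W u w * W u w' else 0)
      (fun k _ => hterm u w w' _) (Finset.mem_range.2 hkN))
    simp [hk1, hk2]
  · rw [if_neg hlt]
    exact Finset.sum_nonneg fun k _ => hterm u w w' _

theorem pow_six_le_of_regular (F : Finset ι) (V : Finset (ι × ι)) (W ρ : ι → ι → ℝ)
    {A B ε q : ℝ} {L : ℕ} (hF : F.Nonempty)
    (hW : ∀ u w, 0 ≤ W u w) (hA : 0 < A) (hB0 : 0 ≤ B) (hε : 0 < ε) (hε1 : ε ≤ 1)
    (hL1 : 2 ^ L * ε ≤ 1) (hL2 : 1 < 2 ^ (L + 1) * ε)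
    (hB : ∀ u ∈ F, ∀ w ∈ F, W u w ≤ B)
    (hρ : ∀ u ∈ F, ∀ w ∈ F, W u w ≠ 0 → |ρ u w - 3 / 4| ≤ 1 / 2)
    (hreg : ∀ u ∈ F, ∀ x h : ℝ, 0 ≤ h →
      ∑ w ∈ F, (if |ρ u w - x| ≤ h then W u w else 0) ≤ A * (h + ε))
    (hreg' : ∀ w ∈ F, ∀ x h : ℝ, 0 ≤ h →
      ∑ u ∈ F, (if |ρ u w - x| ≤ h then W u w else 0) ≤ A * (h + ε))
    (hV : ∀ u ∈ F, ∀ w ∈ F, ∀ w' ∈ F, W u w ≠ 0 → W u w' ≠ 0 → (w, w') ∈ V)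
    (hquad : ∀ u ∈ F, ∀ v ∈ F, ∀ w ∈ F, ∀ w' ∈ F,
      W u w ≠ 0 → W u w' ≠ 0 → W v w ≠ 0 → W v w' ≠ 0 →
      ∃ a b : ℝ, 1 ≤ a ∧ 0 < b ∧
        |a * (ρ u w - ρ v w) * (ρ u w' - ρ u w) +
          b * (ρ u w' - ρ v w') * (ρ v w' - ρ v w)| ≤ ε)
    (hqT : F.card * q ≤ ∑ u ∈ F, ∑ w ∈ F, W u w) :
    q ≤ 4 * A * ε ∨
      F.card * q ^ 6 ≤ 24576 * A ^ 5 * V.card * ((L + 1) * ε * B) := by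
  by_cases hcase : q ≤ 4 * A * ε
  · exact Or.inl hcase
  right
  rw [not_le] at hcase
  have hq : 0 < q := lt_trans (by positivity) hcase
  have hn : 0 < (F.card : ℝ) := by exact_mod_cast hF.card_pos
  have hlt : ε ≤ q / (4 * A) := by rw [le_div_iff₀ (by positivity)]; linarith
  have hfar := sq_le_sum_far F W ρ hW hA hq.le hreg hqT hlt
  set τ := q / (4 * A) with hτ
  have hτ0 : 0 < τ := by positivity
  have hτq : q = 4 * A * τ := by rw [hτ]; field_simp
  have hT : ∀ u ∈ F, ∑ w ∈ F, W u w ≤ 2 * A := by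
    intro u hu
    have h1 := hreg u hu (3 / 4) (1 / 2) (by norm_num)
    have h2 : ∑ w ∈ F, W u w =
        ∑ w ∈ F, (if |ρ u w - 3 / 4| ≤ 1 / 2 then W u w else 0) := by
      refine Finset.sum_congr rfl fun w hw => ?_
      split_ifs with h
      · rfl
      · by_contra h'; exact h (hρ u hu w hw h')
    rw [h2]; nlinarith
  have hq2 : q ≤ 2 * A := by
    have := Finset.sum_le_sum hT
    simp only [Finset.sum_const, nsmul_eq_mul] at this
    exact le_of_mul_le_mul_left (hqT.trans this) hn
  have hτ1 : τ ≤ 1 / 2 := by rw [hτ, div_le_iff₀ (by positivity)]; linarith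
  set N := ⌊5 / (4 * τ)⌋₊ + 1 with hN
  have hN1 : 5 / (4 * τ) < N := by
    simpa [hN] using Nat.lt_floor_add_one (5 / (4 * τ))
  have hN2 : N * τ ≤ 2 := by
    have := Nat.floor_le (show 0 ≤ 5 / (4 * τ) by positivity)
    rw [le_div_iff₀ (by positivity)] at this
    have e : (N : ℝ) = ⌊5 / (4 * τ)⌋₊ + 1 := by simp [hN]
    rw [e]; linarith
  have hsep := hfar.trans (sum_far_le_sum_separated F W ρ N hW hτ0 hN1 hρ)
  have hbad := sum_bad_le F W ρ hW hA.le hB0 hε hε1 hL1 hL2 hB hρ hreg hreg'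
  set Bad := ∑ u ∈ F, ∑ w ∈ F, ∑ w' ∈ F, ∑ v ∈ F,
        (if |ρ u w - ρ v w| * |ρ u w' - ρ u w| ≤ ε then
          W u w * W u w' * W v w * W v w' else 0) with hBad
  have hBad0 : 0 ≤ Bad := by
    refine Finset.sum_nonneg fun u _ => Finset.sum_nonneg fun w _ =>
      Finset.sum_nonneg fun w' _ => Finset.sum_nonneg fun v _ => ?_
    split_ifs
    · have := hW u w; have := hW u w'; have := hW v w; have := hW v w'; positivity
    · exact le_rfl
  have hY : ∀ k ∈ Finset.range N, (∑ u ∈ F, ∑ w ∈ F, ∑ w' ∈ F,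
      if ρ u w < k * τ ∧ k * τ ≤ ρ u w' then W u w * W u w' else 0) ≤
        √(V.card * (2 * Bad)) := fun k _ =>
    Real.le_sqrt_of_sq_le (sq_sum_separated_le F V W ρ ε (k * τ) hW hV hquad)
  have h1 := hsep.trans (Finset.sum_le_sum hY)
  simp only [Finset.sum_const, nsmul_eq_mul, Finset.card_range] at h1
  clear_value Bad
  have hVc : (0 : ℝ) ≤ V.card := Nat.cast_nonneg _
  generalize (V.card : ℝ) = c at *
  generalize (F.card : ℝ) = n at *
  have h2 : n * q ^ 2 / 4 * τ ≤ 2 * √(c * (2 * Bad)) := by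
    have := mul_le_mul_of_nonneg_right h1 hτ0.le
    have h3 := mul_le_mul_of_nonneg_right hN2 (Real.sqrt_nonneg (c * (2 * Bad)))
    nlinarith
  have h3 : (n * q ^ 2 / 4 * τ) ^ 2 ≤ 4 * (c * (2 * Bad)) := by
    calc _ ≤ (2 * √(c * (2 * Bad))) ^ 2 := pow_le_pow_left₀ (by positivity) h2 2
      _ = _ := by rw [mul_pow, Real.sq_sqrt (by positivity)]; norm_num
  have h4 : c * (2 * Bad) ≤
      c * (2 * (n * (2 * A) * ((L + 1) * (6 * A ^ 2 * ε)) * B)) := by gcongr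
  have h5 : n * (n * q ^ 6) ≤
      n * (24576 * A ^ 5 * c * ((L + 1) * ε * B)) := by
    have e : n * (n * q ^ 6) =
        256 * A ^ 2 * (n * q ^ 2 / 4 * τ) ^ 2 := by
      rw [hτ]; field_simp; ring
    rw [e]
    calc _ ≤ 256 * A ^ 2 * (4 * (c *
        (2 * (n * (2 * A) * ((L + 1) * (6 * A ^ 2 * ε)) * B)))) := by
          gcongr; linarith
      _ = _ := by ring
  exact le_of_mul_le_mul_left h5 hn

open Classical in
/-- The number of elements of `F` satisfying `P`, as a real number. -/
def cnt (F : Finset ι) (P : ι → Prop) : ℝ := ((F.filter P).card : ℝ)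

theorem cnt_eq_sum (F : Finset ι) (P : ι → Prop) [DecidablePred P] :
    cnt F P = ∑ w ∈ F, if P w then 1 else 0 := by
  rw [cnt, Finset.card_filter]
  push_cast
  exact Finset.sum_congr rfl fun w _ => by split_ifs <;> rfl

theorem cnt_nonneg (F : Finset ι) (P : ι → Prop) : 0 ≤ cnt F P := Nat.cast_nonneg _

open Classical in
theorem sum_inv_cnt_le (F : Finset ι) (X Y : ι → ℝ) {δ : ℝ} (hδ : 0 < δ) (w : ι) :
    ∑ u ∈ F, (if |X u - X w| ≤ δ ∧ |Y u - Y w| ≤ δ then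
      (cnt F fun w' => (X u - X w') ^ 2 + (Y u - Y w') ^ 2 ≤ δ ^ 2)⁻¹ else 0) ≤ 25 := by
  rw [← Finset.sum_filter]
  set G := F.filter fun u => |X u - X w| ≤ δ ∧ |Y u - Y w| ≤ δ with hG
  set g : ι → ℤ × ℤ := fun u => (⌊(X u - X w) / (δ / 2)⌋, ⌊(Y u - Y w) / (δ / 2)⌋) with hg
  have hfl : ∀ a : ℝ, |a| ≤ δ → ⌊a / (δ / 2)⌋ ∈ Finset.Icc (-2 : ℤ) 2 := by
    intro a ha
    rw [abs_le] at ha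
    rw [Finset.mem_Icc]
    constructor
    · rw [Int.le_floor, le_div_iff₀ (by positivity)]
      push_cast; linarith
    · have : ⌊a / (δ / 2)⌋ < 3 := by
        rw [Int.floor_lt, div_lt_iff₀ (by positivity)]
        push_cast; linarith
      omega
  have hmap : ∀ u ∈ G, g u ∈ Finset.Icc (-2 : ℤ) 2 ×ˢ Finset.Icc (-2 : ℤ) 2 := by
    intro u hu
    rw [hG, Finset.mem_filter] at hu
    exact Finset.mem_product.2 ⟨hfl _ hu.2.1, hfl _ hu.2.2⟩
  rw [← Finset.sum_fiberwise_of_maps_to hmap]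
  have hclose : ∀ a b : ℝ, ⌊a / (δ / 2)⌋ = ⌊b / (δ / 2)⌋ → (a - b) ^ 2 ≤ δ ^ 2 / 4 := by
    intro a b h
    have := Int.abs_sub_lt_one_of_floor_eq_floor h
    rw [← sub_div, abs_div, div_lt_one (by positivity),
      abs_of_pos (by positivity : 0 < δ / 2)] at this
    have h2 := sq_le_sq' (by linarith [neg_abs_le (a - b)]) ((le_abs_self _).trans this.le)
    linarith [h2]
  have hfib : ∀ c ∈ Finset.Icc (-2 : ℤ) 2 ×ˢ Finset.Icc (-2 : ℤ) 2,
      ∑ u ∈ G with g u = c,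
        (cnt F fun w' => (X u - X w') ^ 2 + (Y u - Y w') ^ 2 ≤ δ ^ 2)⁻¹ ≤ 1 := by
    intro c _
    set T := G.filter fun u => g u = c with hT
    have hb : ∀ u ∈ T,
        (cnt F fun w' => (X u - X w') ^ 2 + (Y u - Y w') ^ 2 ≤ δ ^ 2)⁻¹ ≤ (T.card : ℝ)⁻¹ := by
      intro u hu
      have hpos : 0 < (T.card : ℝ) := by exact_mod_cast Finset.card_pos.2 ⟨u, hu⟩
      refine inv_anti₀ hpos ?_
      unfold cnt
      refine Nat.cast_le.2 (Finset.card_le_card fun u' hu' => ?_)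
      have hgu : g u = g u' := by
        rw [hT, Finset.mem_filter] at hu hu'
        rw [hu.2, hu'.2]
      rw [Finset.mem_filter]
      refine ⟨(Finset.mem_filter.1 (Finset.mem_filter.1 hu').1).1, ?_⟩
      have e1 := hclose _ _ (congrArg Prod.fst hgu)
      have e2 := hclose _ _ (congrArg Prod.snd hgu)
      simp only [sub_sub_sub_cancel_right] at e1 e2
      nlinarith [sq_nonneg δ]
    calc _ ≤ ∑ u ∈ T, (T.card : ℝ)⁻¹ := Finset.sum_le_sum hb
      _ = T.card * (T.card : ℝ)⁻¹ := by simp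
      _ ≤ 1 := mul_inv_le_one
  calc _ ≤ ∑ c ∈ Finset.Icc (-2 : ℤ) 2 ×ˢ Finset.Icc (-2 : ℤ) 2, (1 : ℝ) := Finset.sum_le_sum hfib
    _ = 25 := by simp

/-- The parameters at which `u` has at least `θ` neighbours, a fraction `p` of them along `S`. -/
def richSet (F : Finset ι) (nb : ℝ → ι → ι → Prop) (S : ι → ι → Prop) (θ p : ℝ) (u : ι) : Set ℝ :=
  {r | θ ≤ cnt F (nb r u) ∧ p * cnt F (nb r u) ≤ cnt F fun w => nb r u w ∧ S u w}

open Classical in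
/-- The density in `r` of the weight of the edge from `u` to `w`. -/
def edgeDensity (F : Finset ι) (nb : ℝ → ι → ι → Prop) (S : ι → ι → Prop) (θ p : ℝ)
    (u w : ι) (r : ℝ) : ℝ :=
  if (nb r u w ∧ S u w) ∧ r ∈ richSet F nb S θ p u then (cnt F (nb r u))⁻¹ else 0

/-- The weight of the edge from `u` to `w`. -/
def edgeWeight (F : Finset ι) (nb : ℝ → ι → ι → Prop) (S : ι → ι → Prop) (θ p : ℝ)
    (u w : ι) : ℝ :=
  ∫ r in Set.Icc (1 / 2 : ℝ) 1, edgeDensity F nb S θ p u w r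

section
variable {F : Finset ι} {nb : ℝ → ι → ι → Prop} {S : ι → ι → Prop} {θ p : ℝ}

theorem measurable_cnt {P : ℝ → ι → Prop} (h : ∀ w ∈ F, MeasurableSet {r | P r w}) :
    Measurable fun r => cnt F (P r) := by
  classical
  simp only [cnt_eq_sum]
  exact Finset.measurable_fun_sum _ fun w hw =>
    Measurable.ite (h w hw) measurable_const measurable_const

theorem measurableSet_richSet (hnb : ∀ u w, MeasurableSet {r | nb r u w}) (u : ι) :
    MeasurableSet (richSet F nb S θ p u) := by
  have h1 : Measurable fun r => cnt F (nb r u) := measurable_cnt fun w _ => hnb u w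
  have h2 : Measurable fun r => cnt F fun w => nb r u w ∧ S u w :=
    measurable_cnt fun w _ => (hnb u w).inter (MeasurableSet.const _)
  exact (measurableSet_le measurable_const h1).inter
    (measurableSet_le (measurable_const.mul h1) h2)

theorem edgeDensity_nonneg (u w : ι) (r : ℝ) : 0 ≤ edgeDensity F nb S θ p u w r := by
  unfold edgeDensity
  split_ifs
  · exact inv_nonneg.2 (cnt_nonneg _ _)
  · exact le_rfl

theorem edgeDensity_le (hθ : 0 < θ) (u w : ι) (r : ℝ) :
    edgeDensity F nb S θ p u w r ≤ θ⁻¹ := by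
  unfold edgeDensity
  split_ifs with h
  · exact inv_anti₀ hθ h.2.1
  · positivity

theorem measurable_edgeDensity (hnb : ∀ u w, MeasurableSet {r | nb r u w}) (u w : ι) :
    Measurable (edgeDensity F nb S θ p u w) := by
  unfold edgeDensity
  have h1 : Measurable fun r => cnt F (nb r u) := measurable_cnt fun w _ => hnb u w
  exact Measurable.ite (((hnb u w).inter (MeasurableSet.const _)).inter
    (measurableSet_richSet hnb u)) h1.inv measurable_const

theorem integrable_edgeDensity (hnb : ∀ u w, MeasurableSet {r | nb r u w}) (hθ : 0 < θ)
    (u w : ι) :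
    Integrable (edgeDensity F nb S θ p u w) (volume.restrict (Set.Icc (1 / 2 : ℝ) 1)) := by
  refine Integrable.of_bound (C := θ⁻¹) (measurable_edgeDensity hnb u w).aestronglyMeasurable
    (Filter.Eventually.of_forall fun r => ?_)
  rw [Real.norm_of_nonneg (edgeDensity_nonneg u w r)]
  exact edgeDensity_le hθ u w r

theorem edgeWeight_nonneg (u w : ι) : 0 ≤ edgeWeight F nb S θ p u w :=
  integral_nonneg fun r => edgeDensity_nonneg u w r

theorem exists_of_edgeWeight_ne_zero {u w : ι} (h : edgeWeight F nb S θ p u w ≠ 0) :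
    ∃ r ∈ Set.Icc (1 / 2 : ℝ) 1, nb r u w ∧ S u w := by
  by_contra! hcon
  refine h ?_
  unfold edgeWeight
  refine setIntegral_eq_zero_of_forall_eq_zero fun r hr => ?_
  unfold edgeDensity
  rw [if_neg]
  rintro ⟨⟨h1, h2⟩, -⟩
  exact hcon r hr h1 h2

theorem setIntegral_le_of_support {f : ℝ → ℝ} {x h c : ℝ} (hc : 0 ≤ c) (hh : 0 ≤ h)
    (hf : IntegrableOn f (Set.Icc (1 / 2 : ℝ) 1))
    (hb : ∀ r ∈ Set.Icc (1 / 2 : ℝ) 1, f r ≤ c)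
    (hs : ∀ r ∈ Set.Icc (1 / 2 : ℝ) 1, h < |r - x| → f r ≤ 0) :
    ∫ r in Set.Icc (1 / 2 : ℝ) 1, f r ≤ c * (2 * h) := by
  have hInt : Integrable ((Set.Icc (x - h) (x + h)).indicator fun _ : ℝ => c) volume :=
    (integrable_indicator_iff measurableSet_Icc).2 (by simp [IntegrableOn])
  calc _ ≤ ∫ r in Set.Icc (1 / 2 : ℝ) 1, (Set.Icc (x - h) (x + h)).indicator (fun _ => c) r := by
        refine setIntegral_mono_on hf hInt.integrableOn measurableSet_Icc fun r hr => ?_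
        by_cases hm : r ∈ Set.Icc (x - h) (x + h)
        · rw [Set.indicator_of_mem hm]; exact hb r hr
        · rw [Set.indicator_of_notMem hm]
          refine hs r hr ?_
          by_contra! hle
          rw [abs_le] at hle
          exact hm ⟨by linarith, by linarith⟩
    _ ≤ ∫ r, (Set.Icc (x - h) (x + h)).indicator (fun _ => c) r :=
        setIntegral_le_integral hInt (Filter.Eventually.of_forall fun r =>
          Set.indicator_nonneg (fun _ _ => hc) r)
    _ = c * (2 * h) := by
        rw [integral_indicator_const _ measurableSet_Icc, Real.volume_real_Icc_of_le (by linarith),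
          smul_eq_mul]
        ring

theorem cnt_nbr_mul_inv (u : ι) (r : ℝ) (hθ : 0 < θ) (hr : r ∈ richSet F nb S θ p u) :
    p ≤ ∑ w ∈ F, edgeDensity F nb S θ p u w r := by
  classical
  have hpos : 0 < cnt F (nb r u) := hθ.trans_le hr.1
  have e : ∑ w ∈ F, edgeDensity F nb S θ p u w r =
      (cnt F fun w => nb r u w ∧ S u w) * (cnt F (nb r u))⁻¹ := by
    rw [cnt_eq_sum F fun w => nb r u w ∧ S u w, Finset.sum_mul]
    refine Finset.sum_congr rfl fun w _ => ?_
    unfold edgeDensity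
    by_cases h : nb r u w ∧ S u w
    · rw [if_pos ⟨h, hr⟩, if_pos h, one_mul]
    · rw [if_neg (fun hh => h hh.1), if_neg h, zero_mul]
  rw [e, ← div_eq_mul_inv, le_div_iff₀ hpos]
  exact hr.2

theorem sum_edgeDensity_le (u : ι) (r : ℝ) : ∑ w ∈ F, edgeDensity F nb S θ p u w r ≤ 1 := by
  classical
  calc _ ≤ ∑ w ∈ F, (if nb r u w then 1 else 0) * (cnt F (nb r u))⁻¹ := by
        refine Finset.sum_le_sum fun w _ => ?_
        unfold edgeDensity
        have := inv_nonneg.2 (cnt_nonneg F (nb r u))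
        split_ifs with h1 h2 h2
        · simp
        · exact absurd h1.1.1 h2
        · simpa using this
        · simp
    _ = cnt F (nb r u) * (cnt F (nb r u))⁻¹ := by rw [cnt_eq_sum, Finset.sum_mul]
    _ ≤ 1 := mul_inv_le_one

open Classical in
theorem sum_edgeDensity_le' {w : ι} {r : ℝ}
    (hcov : ∑ u ∈ F, (if nb r u w then (cnt F (nb r u))⁻¹ else 0) ≤ 25) :
    ∑ u ∈ F, edgeDensity F nb S θ p u w r ≤ 25 := by
  refine le_trans (Finset.sum_le_sum fun u _ => ?_) hcov
  unfold edgeDensity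
  have := inv_nonneg.2 (cnt_nonneg F (nb r u))
  split_ifs with h1 h2 h2
  · exact le_rfl
  · exact absurd h1.1.1 h2
  · exact this
  · exact le_rfl

open Classical in
theorem single_scale_abstract (V : Finset (ι × ι)) (ρ : ι → ι → ℝ) {κ ε : ℝ} {L : ℕ}
    (hF : F.Nonempty) (hnb : ∀ u w, MeasurableSet {r | nb r u w})
    (hcov : ∀ r, ∀ w ∈ F, ∑ u ∈ F, (if nb r u w then (cnt F (nb r u))⁻¹ else 0) ≤ 25)
    (hθ : 0 < θ) (hκ : 0 < κ) (hκ1 : κ ≤ 1 / 4) (hκε : κ ≤ ε) (hε1 : ε ≤ 1)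
    (hL1 : 2 ^ L * ε ≤ 1) (hL2 : 1 < 2 ^ (L + 1) * ε)
    (hρ : ∀ r ∈ Set.Icc (1 / 2 : ℝ) 1, ∀ u w, nb r u w → S u w → |r - ρ u w| ≤ κ)
    (hV : ∀ u ∈ F, ∀ w ∈ F, ∀ w' ∈ F, (∃ r ∈ Set.Icc (1 / 2 : ℝ) 1, nb r u w ∧ S u w) →
      (∃ r ∈ Set.Icc (1 / 2 : ℝ) 1, nb r u w' ∧ S u w') → (w, w') ∈ V)
    (hquad : ∀ u ∈ F, ∀ v ∈ F, ∀ w ∈ F, ∀ w' ∈ F,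
      (∃ r ∈ Set.Icc (1 / 2 : ℝ) 1, nb r u w ∧ S u w) →
      (∃ r ∈ Set.Icc (1 / 2 : ℝ) 1, nb r u w' ∧ S u w') →
      (∃ r ∈ Set.Icc (1 / 2 : ℝ) 1, nb r v w ∧ S v w) →
      (∃ r ∈ Set.Icc (1 / 2 : ℝ) 1, nb r v w' ∧ S v w') →
      ∃ a b : ℝ, 1 ≤ a ∧ 0 < b ∧
        |a * (ρ u w - ρ v w) * (ρ u w' - ρ u w) +
          b * (ρ u w' - ρ v w') * (ρ v w' - ρ v w)| ≤ ε) {q : ℝ}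
    (hq : F.card * q ≤ p * ∑ u ∈ F,
      (volume.restrict (Set.Icc (1 / 2 : ℝ) 1)).real (richSet F nb S θ p u)) :
    q ≤ 4 * 50 * ε ∨
      F.card * q ^ 6 ≤ 24576 * 50 ^ 5 * V.card * ((L + 1) * ε * (θ⁻¹ * (2 * κ))) := by
  have hInt := fun u w => integrable_edgeDensity (F := F) (S := S) (p := p) hnb hθ u w
  refine pow_six_le_of_regular F V (edgeWeight F nb S θ p) ρ hF edgeWeight_nonneg
    (by norm_num) (by positivity) (hκ.trans_le hκε) hε1 hL1 hL2 ?_ ?_ ?_ ?_ ?_ ?_ ?_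
  · intro u _ w _
    refine setIntegral_le_of_support (x := ρ u w) (by positivity) hκ.le (hInt u w)
      (fun r _ => edgeDensity_le hθ u w r) fun r hr hlt => ?_
    unfold edgeDensity
    rw [if_neg]
    rintro ⟨⟨h1, h2⟩, -⟩
    exact absurd (hρ r hr u w h1 h2) (not_le.2 hlt)
  · intro u _ w _ h
    obtain ⟨r, hr, h1, h2⟩ := exists_of_edgeWeight_ne_zero h
    have h3 := abs_le.1 (hρ r hr u w h1 h2)
    rw [abs_le]
    constructor <;> linarith [hr.1, hr.2]
  · intro u _ x h hh
    have e : ∑ w ∈ F, (if |ρ u w - x| ≤ h then edgeWeight F nb S θ p u w else 0) =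
        ∫ r in Set.Icc (1 / 2 : ℝ) 1, ∑ w ∈ F with |ρ u w - x| ≤ h,
          edgeDensity F nb S θ p u w r := by
      rw [integral_finsetSum _ fun w _ => hInt u w, Finset.sum_filter]
      rfl
    rw [e]
    have h1 := setIntegral_le_of_support (x := x) (h := h + κ) (c := 1) (by norm_num)
      (by positivity) (integrable_finsetSum (F.filter fun w => |ρ u w - x| ≤ h)
        fun w _ => hInt u w) ?_ ?_
    · refine h1.trans ?_
      linarith
    · intro r _
      refine le_trans ?_ (sum_edgeDensity_le (F := F) (nb := nb) (S := S) (θ := θ) (p := p) u r)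
      exact Finset.sum_le_sum_of_subset_of_nonneg (Finset.filter_subset _ _)
        fun w _ _ => edgeDensity_nonneg u w r
    · intro r hr hlt
      refine (Finset.sum_eq_zero fun w hw => ?_).le
      unfold edgeDensity
      rw [if_neg]
      rintro ⟨⟨h1, h2⟩, -⟩
      have h3 := hρ r hr u w h1 h2
      have h4 := (Finset.mem_filter.1 hw).2
      have h5 := abs_sub_le r (ρ u w) x
      linarith
  · intro w hw x h hh
    have e : ∑ u ∈ F, (if |ρ u w - x| ≤ h then edgeWeight F nb S θ p u w else 0) =
        ∫ r in Set.Icc (1 / 2 : ℝ) 1, ∑ u ∈ F with |ρ u w - x| ≤ h,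
          edgeDensity F nb S θ p u w r := by
      rw [integral_finsetSum _ fun u _ => hInt u w, Finset.sum_filter]
      rfl
    rw [e]
    have h1 := setIntegral_le_of_support (x := x) (h := h + κ) (c := 25) (by norm_num)
      (by positivity) (integrable_finsetSum (F.filter fun u => |ρ u w - x| ≤ h)
        fun u _ => hInt u w) ?_ ?_
    · refine h1.trans ?_
      linarith
    · intro r _
      refine le_trans ?_ (sum_edgeDensity_le' (S := S) (θ := θ) (p := p) (hcov r w hw))
      exact Finset.sum_le_sum_of_subset_of_nonneg (Finset.filter_subset _ _)
        fun u _ _ => edgeDensity_nonneg u w r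
    · intro r hr hlt
      refine (Finset.sum_eq_zero fun u hu => ?_).le
      unfold edgeDensity
      rw [if_neg]
      rintro ⟨⟨h1, h2⟩, -⟩
      have h3 := hρ r hr u w h1 h2
      have h4 := (Finset.mem_filter.1 hu).2
      have h5 := abs_sub_le r (ρ u w) x
      linarith
  · intro u hu w hw w' hw' h h'
    exact hV u hu w hw w' hw' (exists_of_edgeWeight_ne_zero h) (exists_of_edgeWeight_ne_zero h')
  · intro u hu v hv w hw w' hw' h1 h2 h3 h4
    exact hquad u hu v hv w hw w' hw' (exists_of_edgeWeight_ne_zero h1)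
      (exists_of_edgeWeight_ne_zero h2) (exists_of_edgeWeight_ne_zero h3)
      (exists_of_edgeWeight_ne_zero h4)
  · refine hq.trans ?_
    rw [Finset.mul_sum]
    refine Finset.sum_le_sum fun u _ => ?_
    have e : ∑ w ∈ F, edgeWeight F nb S θ p u w =
        ∫ r in Set.Icc (1 / 2 : ℝ) 1, ∑ w ∈ F, edgeDensity F nb S θ p u w r := by
      rw [integral_finsetSum _ fun w _ => hInt u w]
      rfl
    have hm := measurableSet_richSet (F := F) (S := S) (θ := θ) (p := p) hnb u
    rw [e, mul_comm, ← smul_eq_mul, ← integral_indicator_const p hm]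
    refine integral_mono ?_ (integrable_finsetSum F fun w _ => hInt u w) fun r => ?_
    · exact (integrable_const p).indicator hm
    · by_cases hr : r ∈ richSet F nb S θ p u
      · simp only [Set.indicator_of_mem hr]
        exact cnt_nbr_mul_inv u r hθ hr
      · simp only [Set.indicator_of_notMem hr]
        exact Finset.sum_nonneg fun w _ => edgeDensity_nonneg u w r
end

end Counting

/-- The points `u` and `w` have `δ`-close images under `π_{t,r}`. -/
def Close (t δ r : ℝ) (u w : E3) : Prop := ‖piProj t r u - piProj t r w‖ ≤ δ

theorem mass_eq_cnt_div {V : Type*} (F : Finset V) (A : Set V) :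
    mass F A = cnt F (fun w => w ∈ A) / F.card := by
  classical
  unfold mass cnt
  congr 2
  have e : A ∩ (F : Set V) = ↑(F.filter fun w => w ∈ A) := by
    ext w
    simp [and_comm]
  rw [e, Nat.card_coe_set_eq, Set.ncard_coe_finset]

theorem norm_sq_piProj_sub (t r : ℝ) (u w : E3) :
    ‖piProj t r u - piProj t r w‖ ^ 2 =
      (Real.exp t * (u 0 + r * u 1 + r ^ 2 / 2 * u 2) -
        Real.exp t * (w 0 + r * w 1 + r ^ 2 / 2 * w 2)) ^ 2 +
      ((u 1 + r * u 2) - (w 1 + r * w 2)) ^ 2 := by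
  rw [EuclideanSpace.norm_sq_eq, Fin.sum_univ_two]
  simp [piProj]

theorem norm_sq_sub_eq (u w : E3) :
    ‖w - u‖ ^ 2 = (w 0 - u 0) ^ 2 + (w 1 - u 1) ^ 2 + (w 2 - u 2) ^ 2 := by
  rw [EuclideanSpace.norm_sq_eq, Fin.sum_univ_three]
  simp

theorem close_iff {t δ r : ℝ} (hδ : 0 ≤ δ) (u w : E3) :
    Close t δ r u w ↔
      (Real.exp t * (u 0 + r * u 1 + r ^ 2 / 2 * u 2) -
        Real.exp t * (w 0 + r * w 1 + r ^ 2 / 2 * w 2)) ^ 2 +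
      ((u 1 + r * u 2) - (w 1 + r * w 2)) ^ 2 ≤ δ ^ 2 := by
  rw [Close, ← norm_sq_piProj_sub, sq_le_sq₀ (norm_nonneg _) hδ]

theorem measurableSet_close (t δ : ℝ) (u w : E3) : MeasurableSet {r | Close t δ r u w} := by
  by_cases hδ : 0 ≤ δ
  · simp only [close_iff hδ]
    refine measurableSet_le (Continuous.measurable ?_) measurable_const
    fun_prop
  · convert MeasurableSet.empty
    ext r
    simp only [Close, Set.mem_ofPred_eq, Set.mem_empty_iff_false, iff_false, not_le]
    exact (not_le.1 hδ).trans_le (norm_nonneg _)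

/-- The defining inequalities for a close pair, in coordinates. -/
theorem Close.abs_coord_le {t δ r : ℝ} {u w : E3} (hδ : 0 ≤ δ) (h : Close t δ r u w) :
    |(w 0 - u 0) + r * (w 1 - u 1) + r ^ 2 / 2 * (w 2 - u 2)| ≤ Real.exp (-t) * δ ∧
      |(w 1 - u 1) + r * (w 2 - u 2)| ≤ δ := by
  rw [close_iff hδ] at h
  constructor
  · have h1 : (Real.exp t * ((w 0 - u 0) + r * (w 1 - u 1) + r ^ 2 / 2 * (w 2 - u 2))) ^ 2 ≤
        δ ^ 2 := by nlinarith [sq_nonneg ((u 1 + r * u 2) - (w 1 + r * w 2))]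
    have h2 := abs_le_of_sq_le_sq h1 hδ
    rw [abs_mul, abs_of_pos (Real.exp_pos t)] at h2
    rw [Real.exp_neg, inv_mul_eq_div, le_div_iff₀ (Real.exp_pos t), mul_comm]
    exact h2
  · refine abs_le_of_sq_le_sq ?_ hδ
    nlinarith [sq_nonneg (Real.exp t * (u 0 + r * u 1 + r ^ 2 / 2 * u 2) -
        Real.exp t * (w 0 + r * w 1 + r ^ 2 / 2 * w 2))]

open Classical in
theorem sum_inv_cnt_close_le (F : Finset E3) (t r : ℝ) {δ : ℝ} (hδ : 0 < δ) (w : E3) :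
    ∑ u ∈ F, (if Close t δ r u w then (cnt F (Close t δ r u))⁻¹ else 0) ≤ 25 := by
  have h0 := sum_inv_cnt_le F (fun u : E3 => Real.exp t * (u 0 + r * u 1 + r ^ 2 / 2 * u 2))
    (fun u => u 1 + r * u 2) hδ w
  refine le_trans (Finset.sum_le_sum fun u _ => ?_) h0
  have e : cnt F (Close t δ r u) = cnt F fun w' =>
      (Real.exp t * (u 0 + r * u 1 + r ^ 2 / 2 * u 2) -
        Real.exp t * (w' 0 + r * w' 1 + r ^ 2 / 2 * w' 2)) ^ 2 +
      ((u 1 + r * u 2) - (w' 1 + r * w' 2)) ^ 2 ≤ δ ^ 2 := by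
    congr 1
    funext w'
    exact propext (close_iff hδ.le u w')
  rw [e]
  have hnn := inv_nonneg.2 (cnt_nonneg F fun w' =>
      (Real.exp t * (u 0 + r * u 1 + r ^ 2 / 2 * u 2) -
        Real.exp t * (w' 0 + r * w' 1 + r ^ 2 / 2 * w' 2)) ^ 2 +
      ((u 1 + r * u 2) - (w' 1 + r * w' 2)) ^ 2 ≤ δ ^ 2)
  split_ifs with h1 h2 h2
  · exact le_rfl
  · rw [close_iff hδ.le] at h1
    refine absurd ⟨abs_le_of_sq_le_sq ?_ hδ.le, abs_le_of_sq_le_sq ?_ hδ.le⟩ h2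
    · nlinarith [sq_nonneg ((u 1 + r * u 2) - (w 1 + r * w 2))]
    · nlinarith [sq_nonneg (Real.exp t * (u 0 + r * u 1 + r ^ 2 / 2 * u 2) -
        Real.exp t * (w 0 + r * w 1 + r ^ 2 / 2 * w 2))]
  · exact hnn
  · exact le_rfl

/-- A short direction of a projection is nearly orthogonal to a long vector only if the
last coordinate is long. -/
theorem le_abs_of_close {x y z r d δ : ℝ} (hr : r ∈ Set.Icc (1 / 2 : ℝ) 1) (hδ : 0 < δ)
    (hd : 20 * δ ≤ d) (hv : d ^ 2 ≤ x ^ 2 + y ^ 2 + z ^ 2)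
    (h1 : |x + r * y + r ^ 2 / 2 * z| ≤ δ) (h2 : |y + r * z| ≤ δ) : d / 3 ≤ |z| := by
  by_contra! hz
  obtain ⟨hr1, hr2⟩ := hr
  have hz0 := abs_nonneg z
  have hy : |y| ≤ |z| + δ := by
    have : y = (y + r * z) - r * z := by ring
    rw [this]
    refine (abs_sub _ _).trans ?_
    rw [abs_mul, abs_of_pos (by linarith : 0 < r)]
    nlinarith
  have hx : |x| ≤ |z| / 2 + 2 * δ := by
    have : x = (x + r * y + r ^ 2 / 2 * z) - r * (y + r * z) + r ^ 2 / 2 * z := by ring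
    rw [this]
    refine (abs_add_le _ _).trans ?_
    have e1 := abs_sub (x + r * y + r ^ 2 / 2 * z) (r * (y + r * z))
    rw [abs_mul, abs_of_pos (by linarith : 0 < r)] at e1
    have e2 : |r ^ 2 / 2 * z| ≤ |z| / 2 := by
      rw [abs_mul, abs_of_nonneg (by positivity)]
      nlinarith [mul_le_mul_of_nonneg_right (show r ^ 2 ≤ 1 by nlinarith) hz0]
    have e3 : r * |y + r * z| ≤ δ := by nlinarith [abs_nonneg (y + r * z)]
    linarith
  have hx2 : x ^ 2 ≤ (d / 6 + d / 10) ^ 2 := sq_le_sq' (by linarith [neg_abs_le x])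
    (by linarith [le_abs_self x])
  have hy2 : y ^ 2 ≤ (d / 3 + d / 20) ^ 2 := sq_le_sq' (by linarith [neg_abs_le y])
    (by linarith [le_abs_self y])
  have hz2 : z ^ 2 ≤ (d / 3) ^ 2 := sq_le_sq' (by linarith [neg_abs_le z])
    (by linarith [le_abs_self z])
  nlinarith [show 0 < d by linarith]

theorem abs_discriminant_le {x y z r d δ : ℝ} (hδ : 0 < δ) (hd : 20 * δ ≤ d)
    (hz : d / 3 ≤ |z|) (h1 : |x + r * y + r ^ 2 / 2 * z| ≤ δ) (h2 : |y + r * z| ≤ δ) :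
    |x - y ^ 2 / (2 * z)| ≤ 2 * δ := by
  have hz0 : 0 < |z| := by linarith
  have hz1 : z ≠ 0 := abs_pos.1 hz0
  have e : x - y ^ 2 / (2 * z) = (x + r * y + r ^ 2 / 2 * z) - (y + r * z) ^ 2 / (2 * z) := by
    field_simp; ring
  rw [e]
  refine (abs_sub _ _).trans ?_
  have : |(y + r * z) ^ 2 / (2 * z)| ≤ δ := by
    rw [abs_div, abs_pow, abs_mul, abs_of_pos (by norm_num : (0 : ℝ) < 2),
      div_le_iff₀ (by positivity)]
    nlinarith [abs_nonneg (y + r * z)]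
  linarith

theorem abs_sub_root_le {y z r d δ : ℝ} (hd : 0 < d) (hz : d / 3 ≤ |z|) (h2 : |y + r * z| ≤ δ) :
    |r - -y / z| ≤ 3 * δ / d := by
  have hz0 : 0 < |z| := by linarith
  have hz1 : z ≠ 0 := abs_pos.1 hz0
  have e : r - -y / z = (y + r * z) / z := by field_simp; ring
  rw [e, abs_div, div_le_div_iff₀ hz0 hd]
  nlinarith [abs_nonneg (y + r * z)]

theorem root_identity {x₁ y₁ z₁ x₁' y₁' z₁' x₂ y₂ z₂ x₂' y₂' z₂' : ℝ}
    (h₁ : z₁ ≠ 0) (h₁' : z₁' ≠ 0) (h₂ : z₂ ≠ 0) (h₂' : z₂' ≠ 0)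
    (hx : x₁ - x₁' = x₂ - x₂') (hy : y₁ - y₁' = y₂ - y₂') (hz : z₁ - z₁' = z₂ - z₂') :
    z₁ * (-y₁ / z₁ - -y₂ / z₂) * (-y₁' / z₁' - -y₁ / z₁) +
      z₂' * (-y₁' / z₁' - -y₂' / z₂') * (-y₂' / z₂' - -y₂ / z₂) =
    2 * ((x₁ - y₁ ^ 2 / (2 * z₁)) - (x₁' - y₁' ^ 2 / (2 * z₁')) -
      (x₂ - y₂ ^ 2 / (2 * z₂)) + (x₂' - y₂' ^ 2 / (2 * z₂'))) := by
  obtain rfl : x₁ = x₂ - x₂' + x₁' := by linarith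
  obtain rfl : y₁ = y₂ - y₂' + y₁' := by linarith
  obtain rfl : z₁ = z₂ - z₂' + z₁' := by linarith
  field_simp
  ring

/-- The pairs at distance about `d`, with the last coordinate of the difference of sign `σ`. -/
def AtScale (d σ : ℝ) (u w : E3) : Prop := d ≤ ‖w - u‖ ∧ ‖w - u‖ < 2 * d ∧ 0 < σ * (w 2 - u 2)

theorem exists_nat_two_pow_mul_le {ε : ℝ} (hε : 0 < ε) (hε1 : ε ≤ 1) :
    ∃ L : ℕ, 2 ^ L * ε ≤ 1 ∧ 1 < 2 ^ (L + 1) * ε ∧ (L + 1 : ℝ) ≤ 40 * ε ^ (-(1 / 20) : ℝ) := by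
  obtain ⟨L, h1, h2⟩ := exists_nat_pow_near (one_le_one_div hε hε1) (one_lt_two)
  rw [le_div_iff₀ hε] at h1
  rw [div_lt_iff₀ hε] at h2
  refine ⟨L, h1, h2, ?_⟩
  have hb : (1 + 1 / 40 : ℝ) ^ 20 ≤ 2 := by norm_num
  have h3 : (1 + 1 / 40 : ℝ) ^ L ≤ ε ^ (-(1 / 20) : ℝ) := by
    have h4 : ((1 + 1 / 40 : ℝ) ^ L) ^ (20 : ℕ) ≤ (ε ^ (-(1 / 20) : ℝ)) ^ (20 : ℕ) := by
      rw [← Real.rpow_natCast (ε ^ _), ← Real.rpow_mul hε.le, ← pow_mul, mul_comm, pow_mul]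
      norm_num
      rw [Real.rpow_neg_one]
      calc _ ≤ (2 : ℝ) ^ L := pow_le_pow_left₀ (by positivity) (by norm_num) L
        _ ≤ _ := by rw [← one_div, le_div_iff₀ hε]; exact h1
    exact le_of_pow_le_pow_left₀ (by norm_num) (by positivity) h4
  have h5 := one_add_mul_le_pow (show (-2 : ℝ) ≤ 1 / 40 by norm_num) L
  linarith

theorem scale_facts {t δ d σ r : ℝ} {u w : E3} (ht : 0 ≤ t) (hδ : 0 < δ) (hd : 48 * δ ≤ d)
    (hσ : |σ| = 1) (hr : r ∈ Set.Icc (1 / 2 : ℝ) 1) (hc : Close t δ r u w)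
    (hs : AtScale d σ u w) :
    d / 3 ≤ σ * (w 2 - u 2) ∧
    |r - -(w 1 - u 1) / (w 2 - u 2)| ≤ 3 * δ / d ∧
    |(w 0 - u 0) - (w 1 - u 1) ^ 2 / (2 * (w 2 - u 2))| ≤ 2 * δ := by
  obtain ⟨h1, h2⟩ := hc.abs_coord_le hδ.le
  have h1' : |(w 0 - u 0) + r * (w 1 - u 1) + r ^ 2 / 2 * (w 2 - u 2)| ≤ δ := by
    refine h1.trans ?_
    have : Real.exp (-t) ≤ 1 := Real.exp_le_one_iff.2 (by linarith)
    nlinarith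
  have hd0 : 0 < d := by linarith
  have hv : d ^ 2 ≤ (w 0 - u 0) ^ 2 + (w 1 - u 1) ^ 2 + (w 2 - u 2) ^ 2 := by
    rw [← norm_sq_sub_eq]
    exact pow_le_pow_left₀ hd0.le hs.1 2
  have hz := le_abs_of_close hr hδ (by linarith) hv h1' h2
  refine ⟨?_, abs_sub_root_le hd0 hz h2, abs_discriminant_le hδ (by linarith) hz h1' h2⟩
  rw [← abs_of_pos hs.2.2, abs_mul, hσ, one_mul]
  exact hz

theorem single_scale {F : Finset E3} (hF : F.Nonempty) {t δ d θ p q C σ : ℝ} (ht : 0 ≤ t)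
    (hδ : 0 < δ) (hd : 48 * δ ≤ d) (hσ : |σ| = 1) (hθ : 0 < θ)
    (hmass : ∀ w ∈ F, cnt F (fun w' => ‖w' - w‖ ≤ 4 * d) ≤ F.card * C)
    (hq : F.card * q ≤ p * ∑ u ∈ F, (volume.restrict (Set.Icc (1 / 2 : ℝ) 1)).real
      (richSet F (Close t δ) (AtScale d σ) (F.card * θ) p u)) :
    q ≤ 9600 * (δ / d) ∨ q ^ 6 ≤ 24576 * 50 ^ 5 * (40 * 48 * 6) *
      (C * θ⁻¹ * (δ / d) ^ 2 * (δ / d) ^ (-(1 / 20) : ℝ)) := by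
  classical
  have hd0 : 0 < d := by linarith
  have hn : 0 < (F.card : ℝ) := by exact_mod_cast hF.card_pos
  set ε := 48 * δ / d with hε
  have hε0 : 0 < ε := by positivity
  have hε1 : ε ≤ 1 := by rw [hε, div_le_one hd0]; exact hd
  obtain ⟨L, hL1, hL2, hL3⟩ := exists_nat_two_pow_mul_le hε0 hε1
  set ρ : E3 → E3 → ℝ := fun u w => -(w 1 - u 1) / (w 2 - u 2) with hρ
  set V : Finset (E3 × E3) := (F ×ˢ F).filter fun x => ‖x.2 - x.1‖ ≤ 4 * d with hV
  have hVcard : (V.card : ℝ) ≤ F.card * (F.card * C) := by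
    have e : (V.card : ℝ) = ∑ w ∈ F, cnt F (fun w' => ‖w' - w‖ ≤ 4 * d) := by
      simp only [cnt_eq_sum, hV, Finset.card_filter, Finset.sum_product]
      push_cast
      rfl
    rw [e]
    refine (Finset.sum_le_sum hmass).trans ?_
    simp
  have hC : 0 ≤ C := by
    obtain ⟨w, hw⟩ := hF
    exact nonneg_of_mul_nonneg_right ((cnt_nonneg _ _).trans (hmass w hw)) hn
  have hdich := single_scale_abstract (F := F) (nb := Close t δ) (S := AtScale d σ)
    (θ := F.card * θ) (p := p) V ρ (κ := 3 * δ / d) (ε := ε) (L := L) hF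
    (measurableSet_close t δ) (fun r w _ => sum_inv_cnt_close_le F t r hδ w)
    (by positivity) (by positivity)
    (by rw [div_le_iff₀ hd0]; linarith)
    (by rw [hε]; gcongr; norm_num) hε1 hL1 hL2
    (fun r hr u w h1 h2 => (scale_facts ht hδ hd hσ hr h1 h2).2.1) ?_ ?_ hq
  · rcases hdich with h | h
    · left
      refine h.trans (le_of_eq ?_)
      rw [hε]; ring
    · right
      have hD : 0 < δ / d := by positivity
      have hL4 : (L + 1 : ℝ) ≤ 40 * (δ / d) ^ (-(1 / 20) : ℝ) := by
        have hDε : δ / d ≤ ε := by rw [hε]; gcongr; linarith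
        exact hL3.trans (mul_le_mul_of_nonneg_left
          (Real.rpow_le_rpow_of_nonpos hD hDε (by norm_num)) (by norm_num))
      have h' : F.card * q ^ 6 ≤ F.card * (24576 * 50 ^ 5 * (40 * 48 * 6) *
          (C * θ⁻¹ * (δ / d) ^ 2 * (δ / d) ^ (-(1 / 20) : ℝ))) := by
        refine h.trans ?_
        calc _ ≤ 24576 * 50 ^ 5 * (F.card * (F.card * C)) *
              ((40 * (δ / d) ^ (-(1 / 20) : ℝ)) * ε *
                ((F.card * θ)⁻¹ * (2 * (3 * δ / d)))) := by
              gcongr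
          _ = _ := by
              rw [hε]; field_simp; ring
      exact le_of_mul_le_mul_left h' hn
  · rintro u hu w hw w' hw' ⟨r, hr, h1, h2⟩ ⟨r', hr', h1', h2'⟩
    rw [hV, Finset.mem_filter, Finset.mem_product]
    refine ⟨⟨hw, hw'⟩, ?_⟩
    have e : w' - w = (w' - u) - (w - u) := by abel
    simp only [e]
    refine (norm_sub_le _ _).trans ?_
    linarith [h2.2.1, h2'.2.1]
  · rintro u hu v hv w hw w' hw' ⟨r₁, hr₁, c₁, s₁⟩ ⟨r₁', hr₁', c₁', s₁'⟩ ⟨r₂, hr₂, c₂, s₂⟩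
      ⟨r₂', hr₂', c₂', s₂'⟩
    obtain ⟨z₁, -, k₁⟩ := scale_facts ht hδ hd hσ hr₁ c₁ s₁
    obtain ⟨z₁', -, k₁'⟩ := scale_facts ht hδ hd hσ hr₁' c₁' s₁'
    obtain ⟨z₂, -, k₂⟩ := scale_facts ht hδ hd hσ hr₂ c₂ s₂
    obtain ⟨z₂', -, k₂'⟩ := scale_facts ht hδ hd hσ hr₂' c₂' s₂'
    have nz : ∀ z : ℝ, d / 3 ≤ σ * z → z ≠ 0 := by
      rintro z h rfl
      rw [mul_zero] at h
      linarith
    refine ⟨3 / d * (σ * (w 2 - u 2)), 3 / d * (σ * (w' 2 - v 2)), ?_, ?_, ?_⟩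
    · rw [div_mul_eq_mul_div, le_div_iff₀ hd0]; linarith
    · have := s₂'.2.2; positivity
    · have hid := root_identity (x₁ := w 0 - u 0) (y₁ := w 1 - u 1) (x₁' := w' 0 - u 0)
        (y₁' := w' 1 - u 1) (x₂ := w 0 - v 0) (y₂ := w 1 - v 1) (x₂' := w' 0 - v 0)
        (y₂' := w' 1 - v 1) (nz _ z₁) (nz _ z₁') (nz _ z₂) (nz _ z₂') (by ring) (by ring)
        (by ring)
      have e : 3 / d * (σ * (w 2 - u 2)) * (ρ u w - ρ v w) * (ρ u w' - ρ u w) +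
          3 / d * (σ * (w' 2 - v 2)) * (ρ u w' - ρ v w') * (ρ v w' - ρ v w) =
          3 / d * σ * ((w 2 - u 2) * (ρ u w - ρ v w) * (ρ u w' - ρ u w) +
          (w' 2 - v 2) * (ρ u w' - ρ v w') * (ρ v w' - ρ v w)) := by ring
      rw [e]
      simp only [hρ]
      rw [hid, abs_mul, abs_mul, hσ, mul_one, abs_of_pos (by positivity : 0 < 3 / d), hε,
        abs_mul, abs_of_pos (by norm_num : (0 : ℝ) < 2), div_mul_eq_mul_div]
      refine div_le_div_of_nonneg_right ?_ hd0.le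
      have b : ∀ a b c e : ℝ, |a| ≤ 2 * δ → |b| ≤ 2 * δ → |c| ≤ 2 * δ → |e| ≤ 2 * δ →
          3 * (2 * |a - b - c + e|) ≤ 48 * δ := by
        intro a b c e ha hb hc he
        rw [abs_le] at ha hb hc he
        have : |a - b - c + e| ≤ 8 * δ := abs_le.2 ⟨by linarith, by linarith⟩
        linarith
      exact b _ _ _ _ k₁ k₁' k₂ k₂'

theorem norm_lt_of_three_points {x y z N m ℓ a b c : ℝ} (hN : N ^ 2 = x ^ 2 + y ^ 2 + z ^ 2)
    (hm : 0 < m) (hℓ : 0 < ℓ) (ia : a ∈ Set.Icc (1 / 2 : ℝ) 1) (ib : b ∈ Set.Icc (1 / 2 : ℝ) 1)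
    (ic : c ∈ Set.Icc (1 / 2 : ℝ) 1) (hab : ℓ / 8 < |a - b|) (hac : ℓ / 8 < |a - c|)
    (hbc : ℓ / 8 < |b - c|) (ha : |x + a * y + a ^ 2 / 2 * z| ≤ m)
    (hb : |x + b * y + b ^ 2 / 2 * z| ≤ m) (hc : |x + c * y + c ^ 2 / 2 * z| ≤ m) :
    N < 9 * (64 * m / ℓ ^ 2) := by
  have nab : a - b ≠ 0 := abs_pos.1 (lt_trans (by positivity) hab)
  have nac : a - c ≠ 0 := abs_pos.1 (lt_trans (by positivity) hac)
  have nbc : b - c ≠ 0 := abs_pos.1 (lt_trans (by positivity) hbc)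
  have hba : ℓ / 8 < |b - a| := by rwa [abs_sub_comm]
  have hca : ℓ / 8 < |c - a| := by rwa [abs_sub_comm]
  have hcb : ℓ / 8 < |c - b| := by rwa [abs_sub_comm]
  set k := 64 * m / ℓ ^ 2 with hk
  have hquot : ∀ f p q : ℝ, |f| ≤ m → ℓ / 8 < |p| → ℓ / 8 < |q| → |f / (p * q)| < k := by
    intro f p q h1 h2 h3
    have h4 : ℓ / 8 * (ℓ / 8) < |p| * |q| := mul_lt_mul'' h2 h3 (by positivity) (by positivity)
    rw [abs_div, abs_mul, hk, div_lt_div_iff₀ (by nlinarith [sq_nonneg ℓ]) (by positivity)]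
    nlinarith [abs_nonneg f, sq_nonneg ℓ]
  have ea := hquot _ _ _ ha hab hac
  have eb := hquot _ _ _ hb hba hbc
  have ec := hquot _ _ _ hc hca hcb
  set A := (x + a * y + a ^ 2 / 2 * z) / ((a - b) * (a - c)) with hA
  set B := (x + b * y + b ^ 2 / 2 * z) / ((b - a) * (b - c)) with hB
  set D := (x + c * y + c ^ 2 / 2 * z) / ((c - a) * (c - b)) with hD
  have ez : z = 2 * (A + B + D) := by
    rw [hA, hB, hD]
    rw [← neg_sub a b, ← neg_sub a c, ← neg_sub b c]
    field_simp; ring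
  have ey : y = -(A * (b + c) + B * (a + c) + D * (a + b)) := by
    rw [hA, hB, hD]
    rw [← neg_sub a b, ← neg_sub a c, ← neg_sub b c]
    field_simp; ring
  have ex : x = A * (b * c) + B * (a * c) + D * (a * b) := by
    rw [hA, hB, hD]
    rw [← neg_sub a b, ← neg_sub a c, ← neg_sub b c]
    field_simp; ring
  have hk0 : 0 < k := by positivity
  obtain ⟨a1, a2⟩ := ia
  obtain ⟨b1, b2⟩ := ib
  obtain ⟨c1, c2⟩ := ic
  have hbd : ∀ P c e : ℝ, 0 ≤ c → c ≤ e → |P| < k → |P * c| ≤ e * k := by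
    intro P c e h0 h1 h2
    rw [abs_mul, abs_of_nonneg h0, mul_comm]
    exact mul_le_mul h1 h2.le (abs_nonneg _) (h0.trans h1)
  have zb : |z| < 6 * k := by
    rw [ez, abs_lt]
    rw [abs_lt] at ea eb ec
    constructor <;> linarith
  have yb : |y| ≤ 6 * k := by
    have i1 := abs_le.1 (hbd A (b + c) 2 (by linarith) (by linarith) ea)
    have i2 := abs_le.1 (hbd B (a + c) 2 (by linarith) (by linarith) eb)
    have i3 := abs_le.1 (hbd D (a + b) 2 (by linarith) (by linarith) ec)
    rw [ey, abs_le]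
    constructor <;> linarith
  have xb : |x| ≤ 3 * k := by
    have i1 := abs_le.1 (hbd A (b * c) 1 (mul_nonneg (by linarith) (by linarith))
      (mul_le_one₀ (by linarith) (by linarith) (by linarith)) ea)
    have i2 := abs_le.1 (hbd B (a * c) 1 (mul_nonneg (by linarith) (by linarith))
      (mul_le_one₀ (by linarith) (by linarith) (by linarith)) eb)
    have i3 := abs_le.1 (hbd D (a * b) 1 (mul_nonneg (by linarith) (by linarith))
      (mul_le_one₀ (by linarith) (by linarith) (by linarith)) ec)
    rw [ex, abs_le]
    constructor <;> linarith
  have hsq : N ^ 2 < (9 * k) ^ 2 := by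
    have h1 : z ^ 2 < (6 * k) ^ 2 :=
      sq_lt_sq' (by linarith [neg_abs_le z]) ((le_abs_self z).trans_lt zb)
    have h2 : y ^ 2 ≤ (6 * k) ^ 2 :=
      sq_le_sq' (by linarith [neg_abs_le y]) ((le_abs_self y).trans yb)
    have h3 : x ^ 2 ≤ (3 * k) ^ 2 :=
      sq_le_sq' (by linarith [neg_abs_le x]) ((le_abs_self x).trans xb)
    rw [hN]; nlinarith
  exact lt_of_pow_lt_pow_left₀ 2 (by positivity) hsq

theorem volume_sublevel_le {E : Set ℝ} (hE : E ⊆ Set.Icc (1 / 2 : ℝ) 1) {x y z N m ℓ : ℝ}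
    (hN : N ^ 2 = x ^ 2 + y ^ 2 + z ^ 2) (hm : 0 < m) (hℓ : 0 < ℓ) (hNℓ : 576 * m ≤ N * ℓ ^ 2)
    (hf : ∀ r ∈ E, |x + r * y + r ^ 2 / 2 * z| ≤ m) : volume E ≤ ENNReal.ofReal ℓ := by
  by_contra! hlt
  have hI : ∀ c, volume (Set.Icc (c - ℓ / 8) (c + ℓ / 8)) = ENNReal.ofReal (ℓ / 4) := by
    intro c
    rw [Real.volume_Icc]
    congr 1; ring
  have hpick : ∀ a b : ℝ, ∃ r ∈ E, ℓ / 8 < |r - a| ∧ ℓ / 8 < |r - b| := by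
    intro a b
    by_contra! hcon
    have hsub : E ⊆ Set.Icc (a - ℓ / 8) (a + ℓ / 8) ∪ Set.Icc (b - ℓ / 8) (b + ℓ / 8) := by
      intro r hr
      by_cases h : ℓ / 8 < |r - a|
      · right
        have := abs_le.1 (hcon r hr h)
        constructor <;> linarith
      · left
        have := abs_le.1 (not_lt.1 h)
        constructor <;> linarith
    have h1 := (measure_mono hsub).trans (measure_union_le (μ := volume) _ _)
    rw [hI, hI, ← ENNReal.ofReal_add (by positivity) (by positivity)] at h1
    have h2 := ENNReal.ofReal_le_ofReal (show ℓ / 4 + ℓ / 4 ≤ ℓ by linarith)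
    exact absurd hlt (not_lt.2 (h1.trans h2))
  obtain ⟨a, haE, -, -⟩ := hpick 0 0
  obtain ⟨b, hbE, hba, -⟩ := hpick a a
  obtain ⟨c, hcE, hca, hcb⟩ := hpick a b
  have hab : ℓ / 8 < |a - b| := by rwa [abs_sub_comm]
  have hac : ℓ / 8 < |a - c| := by rwa [abs_sub_comm]
  have hbc : ℓ / 8 < |b - c| := by rwa [abs_sub_comm]
  have hNk := norm_lt_of_three_points hN hm hℓ (hE haE) (hE hbE) (hE hcE) hab hac hbc
    (hf a haE) (hf b hbE) (hf c hcE)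
  have : N * ℓ ^ 2 < 576 * m := by
    calc N * ℓ ^ 2 < 9 * (64 * m / ℓ ^ 2) * ℓ ^ 2 := by gcongr
      _ = _ := by field_simp; norm_num
  linarith

theorem close_measureReal_le {t δ ℓ : ℝ} {u w : E3} (hδ : 0 < δ) (hℓ : 0 < ℓ)
    (h : 576 * (Real.exp (-t) * δ) ≤ ‖w - u‖ * ℓ ^ 2) :
    (volume.restrict (Set.Icc (1 / 2 : ℝ) 1)).real {r | Close t δ r u w} ≤ ℓ := by
  rw [measureReal_restrict_apply (measurableSet_close t δ u w), measureReal_def]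
  refine ENNReal.toReal_le_of_le_ofReal hℓ.le ?_
  exact volume_sublevel_le Set.inter_subset_right (norm_sq_sub_eq u w) (by positivity) hℓ h
    fun r hr => (Close.abs_coord_le hδ.le hr.1).1

theorem sum_measureReal_mid_le {F : Finset E3} (hF : F.Nonempty) {t δ s d ℓ θ C : ℝ}
    (hδ : 0 < δ) (hℓ : 0 < ℓ) (hsℓ : 576 * (Real.exp (-t) * δ) ≤ s * ℓ ^ 2)
    (hmass : ∀ w ∈ F, cnt F (fun w' => ‖w' - w‖ ≤ d) ≤ F.card * C) :
    θ * ∑ u ∈ F, (volume.restrict (Set.Icc (1 / 2 : ℝ) 1)).real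
      {r | F.card * θ ≤ cnt F fun w => Close t δ r u w ∧ s < ‖w - u‖ ∧ ‖w - u‖ < d} ≤
    F.card * (C * ℓ) := by
  classical
  have hn : 0 < (F.card : ℝ) := by exact_mod_cast hF.card_pos
  set ν := volume.restrict (Set.Icc (1 / 2 : ℝ) 1) with hν
  have key : ∀ u ∈ F, F.card * θ * ν.real
      {r | F.card * θ ≤ cnt F fun w => Close t δ r u w ∧ s < ‖w - u‖ ∧ ‖w - u‖ < d} ≤
      F.card * C * ℓ := by
    intro u hu
    have hms : ∀ w, MeasurableSet {r | Close t δ r u w ∧ s < ‖w - u‖ ∧ ‖w - u‖ < d} := fun w =>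
      (measurableSet_close t δ u w).inter (MeasurableSet.const _)
    have hind : ∀ w, (fun r => if Close t δ r u w ∧ s < ‖w - u‖ ∧ ‖w - u‖ < d then (1 : ℝ) else 0) =
        {r | Close t δ r u w ∧ s < ‖w - u‖ ∧ ‖w - u‖ < d}.indicator fun _ => (1 : ℝ) := by
      intro w
      funext r
      simp [Set.indicator_apply]
    have hInt : ∀ w ∈ F, Integrable (fun r =>
        if Close t δ r u w ∧ s < ‖w - u‖ ∧ ‖w - u‖ < d then (1 : ℝ) else 0) ν := by
      intro w _
      rw [hind]
      exact (integrable_const (1 : ℝ)).indicator (hms w)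
    have hmarkov := mul_meas_ge_le_integral_of_nonneg (μ := ν)
      (f := fun r => cnt F fun w => Close t δ r u w ∧ s < ‖w - u‖ ∧ ‖w - u‖ < d)
      (Filter.Eventually.of_forall fun r => cnt_nonneg _ _)
      (by simp only [cnt_eq_sum]; exact integrable_finsetSum F hInt) (F.card * θ)
    refine hmarkov.trans ?_
    simp only [cnt_eq_sum]
    rw [integral_finsetSum F hInt]
    have hle : ∀ w ∈ F,
        ∫ r, (if Close t δ r u w ∧ s < ‖w - u‖ ∧ ‖w - u‖ < d then (1 : ℝ) else 0) ∂ν ≤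
        (if ‖w - u‖ ≤ d then 1 else 0) * ℓ := by
      intro w _
      rw [hind, integral_indicator_const _ (hms w), smul_eq_mul, mul_one]
      by_cases h : s < ‖w - u‖ ∧ ‖w - u‖ < d
      · rw [if_pos h.2.le, one_mul]
        refine le_trans (measureReal_mono fun r hr => hr.1)
          (close_measureReal_le hδ hℓ (hsℓ.trans ?_))
        gcongr
        exact h.1.le
      · have e : {r | Close t δ r u w ∧ s < ‖w - u‖ ∧ ‖w - u‖ < d} = ∅ := by
          ext r
          simp only [Set.mem_ofPred_eq, Set.mem_empty_iff_false, iff_false]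
          exact fun hh => h hh.2
        rw [e, measureReal_empty]
        positivity
    refine (Finset.sum_le_sum hle).trans ?_
    rw [← Finset.sum_mul, ← cnt_eq_sum F fun w => ‖w - u‖ ≤ d]
    exact mul_le_mul_of_nonneg_right (hmass u hu) hℓ.le
  have hsum := Finset.sum_le_sum key
  rw [← Finset.mul_sum] at hsum
  simp only [Finset.sum_const, nsmul_eq_mul] at hsum
  refine le_of_mul_le_mul_left ?_ hn
  linarith

theorem cnt_le_add {ι : Type*} (F : Finset ι) {P Q R : ι → Prop}
    (h : ∀ w ∈ F, P w → Q w ∨ R w) : cnt F P ≤ cnt F Q + cnt F R := by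
  classical
  unfold cnt
  have h1 : F.filter P ⊆ F.filter Q ∪ F.filter R := fun w hw => by
    simp only [Finset.mem_filter, Finset.mem_union] at hw ⊢
    exact (h w hw.1 hw.2).imp (fun h => ⟨hw.1, h⟩) fun h => ⟨hw.1, h⟩
  exact_mod_cast (Finset.card_le_card h1).trans (Finset.card_union_le _ _)

theorem cnt_le_sum {ι J : Type*} (F : Finset ι) (s : Finset J) {P : ι → Prop} {Q : J → ι → Prop}
    (h : ∀ w ∈ F, P w → ∃ j ∈ s, Q j w) : cnt F P ≤ ∑ j ∈ s, cnt F (Q j) := by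
  classical
  unfold cnt
  have h1 : F.filter P ⊆ s.biUnion fun j => F.filter (Q j) := fun w hw => by
    simp only [Finset.mem_filter, Finset.mem_biUnion] at hw ⊢
    obtain ⟨j, hj, hQ⟩ := h w hw.1 hw.2
    exact ⟨j, hj, hw.1, hQ⟩
  exact_mod_cast (Finset.card_le_card h1).trans Finset.card_biUnion_le

theorem rpow_mul_exp_le {X α t b : ℝ} (hX : 0 < X) (hX1 : X ≤ 1) (hα : α ≤ 3 / 2) (hb : 0 < b)
    (ht : 0 ≤ t) (h : X ≤ b ^ 20 * Real.exp (-(9 * t / 40))) :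
    X ^ (2 - α - 1 / 20) * Real.exp (t / 10) ≤ b ^ 9 := by
  have h1 : X ^ (2 - α - 1 / 20) ≤ X ^ (9 / 20 : ℝ) :=
    Real.rpow_le_rpow_of_exponent_ge hX hX1 (by linarith)
  have h2 : X ^ (9 / 20 : ℝ) ≤ (b ^ 20 * Real.exp (-(9 * t / 40))) ^ (9 / 20 : ℝ) :=
    Real.rpow_le_rpow hX.le h (by norm_num)
  have h3 : (b ^ 20 * Real.exp (-(9 * t / 40))) ^ (9 / 20 : ℝ) =
      b ^ 9 * Real.exp (-(81 * t / 800)) := by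
    rw [Real.mul_rpow (by positivity) (Real.exp_pos _).le, ← Real.rpow_natCast b 20,
      ← Real.rpow_mul hb.le, ← Real.exp_mul, ← Real.rpow_natCast b 9]
    congr 2
    · norm_num
    · ring
  calc _ ≤ b ^ 9 * Real.exp (-(81 * t / 800)) * Real.exp (t / 10) := by
        rw [← h3]; gcongr; exact h1.trans h2
    _ = b ^ 9 * Real.exp (-(t / 800)) := by
        rw [mul_assoc, ← Real.exp_add]; congr 2; ring
    _ ≤ b ^ 9 * 1 := by
        gcongr
        exact Real.exp_le_one_iff.2 (by linarith)
    _ = b ^ 9 := mul_one _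

theorem half_pow_le (i : ℕ) : (1 / 2 : ℝ) ^ i ≤ ((79 / 80 : ℝ) ^ (2 * i)) ^ 20 := by
  rw [← pow_mul, show 2 * i * 20 = 40 * i by ring, pow_mul]
  gcongr
  norm_num

theorem sum_richSet_le {F : Finset E3} (hF : F.Nonempty) {α δ₀ C₀ t δ K σ : ℝ} (i : ℕ)
    (hα : α ≤ 3 / 2) (hC₀ : 1 ≤ C₀) (ht : 0 ≤ t) (hδ : 0 < δ) (hδ₀ : δ₀ ≤ δ)
    (hK : 2 ≤ K) (hσ : |σ| = 1)
    (hmass : ∀ w : E3, ∀ ρ : ℝ, δ₀ ≤ ρ →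
      cnt F (fun w' => ‖w' - w‖ ≤ ρ) ≤ F.card * (C₀ * ρ ^ α)) :
    ∑ u ∈ F, (volume.restrict (Set.Icc (1 / 2 : ℝ) 1)).real
      (richSet F (Close t δ) (AtScale (2 ^ i * (20 * K ^ 3 * δ * Real.exp (9 * t / 40))) σ)
        (F.card * (C₀ * Real.exp (-t / 10) * (δ ^ α * K ^ 18))) ((79 / 80) ^ i / 560) u) ≤
      F.card * (5376000 / K ^ 3 * (79 / 80) ^ (2 * i)) := by
  have hn : 0 < (F.card : ℝ) := by exact_mod_cast hF.card_pos
  set d := 2 ^ i * (20 * K ^ 3 * δ * Real.exp (9 * t / 40)) with hd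
  set θ := C₀ * Real.exp (-t / 10) * (δ ^ α * K ^ 18) with hθ
  have hK0 : 0 < K := by linarith
  have hC0 : 0 < C₀ := by linarith
  have hd0 : 0 < d := by positivity
  have hθ0 : 0 < θ := by positivity
  have hK3 : 8 ≤ K ^ 3 := by
    calc (8 : ℝ) = 2 ^ 3 := by norm_num
      _ ≤ K ^ 3 := by gcongr
  have he : 1 ≤ Real.exp (9 * t / 40) := Real.one_le_exp (by positivity)
  have h2i : (1 : ℝ) ≤ 2 ^ i := one_le_pow₀ (by norm_num)
  have hdδ : 48 * δ ≤ d := by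
    calc 48 * δ ≤ 1 * (20 * 8 * δ * 1) := by linarith
      _ ≤ d := by rw [hd]; gcongr
  set Q := ∑ u ∈ F, (volume.restrict (Set.Icc (1 / 2 : ℝ) 1)).real
      (richSet F (Close t δ) (AtScale d σ) (F.card * θ) ((79 / 80) ^ i / 560) u) with hQ
  set p : ℝ := (79 / 80) ^ i / 560 with hp
  have hp0 : 0 < p := by positivity
  have hX0 : 0 < δ / d := by positivity
  have hX1 : δ / d ≤ 1 := by rw [div_le_one hd0]; linarith
  have hXe : δ / d = (1 / 2) ^ i * Real.exp (-(9 * t / 40)) / (20 * K ^ 3) := by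
    rw [hd, Real.exp_neg, one_div, inv_pow]
    field_simp
  have hβ0 : 0 < (79 / 80 : ℝ) ^ (2 * i) := by positivity
  have hβ1 : (79 / 80 : ℝ) ^ (2 * i) ≤ 1 := pow_le_one₀ (by norm_num) (by norm_num)
  have hexp1 : Real.exp (-(9 * t / 40)) ≤ 1 := Real.exp_le_one_iff.2 (by linarith)
  have hXle : δ / d ≤ ((79 / 80 : ℝ) ^ (2 * i)) ^ 20 * Real.exp (-(9 * t / 40)) := by
    rw [hXe]
    calc _ ≤ (1 / 2) ^ i * Real.exp (-(9 * t / 40)) := div_le_self (by positivity) (by linarith)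
      _ ≤ _ := by gcongr; exact half_pow_le i
  have hbb : (1 / 2 : ℝ) ^ i ≤ (79 / 80) ^ (3 * i) := by
    rw [pow_mul]; gcongr; norm_num
  have hq : p * (Q / F.card) ≤ 9600 * ((79 / 80) ^ (3 * i) / K ^ 3) := by
    have hdich := single_scale (F := F) (t := t) (δ := δ) (d := d) (θ := θ) (p := p)
      (q := p * (Q / F.card)) (C := C₀ * (4 * d) ^ α) (σ := σ) hF ht hδ hdδ hσ hθ0
      (fun w _ => hmass w (4 * d) (by linarith)) (by rw [← hQ]; field_simp; exact le_rfl)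
    rcases hdich with h | h
    · refine h.trans (mul_le_mul_of_nonneg_left ?_ (by norm_num))
      rw [hXe]
      gcongr
      · calc _ ≤ (1 / 2 : ℝ) ^ i * 1 := by gcongr
          _ ≤ _ := by rw [mul_one]; exact hbb
      · linarith
    · refine le_of_pow_le_pow_left₀ (n := 6) (by norm_num) (by positivity) (h.trans ?_)
      have h4 : (4 * d) ^ α ≤ 8 * d ^ α := by
        rw [Real.mul_rpow (by norm_num) hd0.le]
        gcongr
        calc (4 : ℝ) ^ α ≤ 4 ^ (3 / 2 : ℝ) :=
              Real.rpow_le_rpow_of_exponent_le (by norm_num) hα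
          _ = 8 := by
              rw [show (4 : ℝ) = 2 ^ (2 : ℝ) by norm_num, ← Real.rpow_mul (by norm_num)]
              norm_num
      have h5 : C₀ * d ^ α * θ⁻¹ = (δ / d) ^ (-α) * Real.exp (t / 10) / K ^ 18 := by
        rw [hθ, Real.rpow_neg hX0.le, Real.div_rpow hδ.le hd0.le, neg_div, Real.exp_neg]
        have : 0 < δ ^ α := by positivity
        have : 0 < d ^ α := by positivity
        field_simp
      have h6 : (δ / d) ^ (-α) * (δ / d) ^ 2 * (δ / d) ^ (-(1 / 20) : ℝ) =
          (δ / d) ^ (2 - α - 1 / 20) := by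
        rw [← Real.rpow_natCast (δ / d) 2, ← Real.rpow_add hX0, ← Real.rpow_add hX0]
        congr 1; push_cast; ring
      have h7 := rpow_mul_exp_le hX0 hX1 hα hβ0 ht hXle
      calc _ ≤ 24576 * 50 ^ 5 * (40 * 48 * 6) * (C₀ * (8 * d ^ α) * θ⁻¹ * (δ / d) ^ 2 *
            (δ / d) ^ (-(1 / 20) : ℝ)) := by gcongr
        _ = 24576 * 50 ^ 5 * (40 * 48 * 6) * 8 * (C₀ * d ^ α * θ⁻¹ * (δ / d) ^ 2 *
            (δ / d) ^ (-(1 / 20) : ℝ)) := by ring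
        _ = 24576 * 50 ^ 5 * (40 * 48 * 6) * 8 * ((δ / d) ^ (2 - α - 1 / 20) *
            Real.exp (t / 10) / K ^ 18) := by
              rw [h5, ← h6]; ring
        _ ≤ 9600 ^ 6 * (((79 / 80) ^ (2 * i)) ^ 9 / K ^ 18) := by
              gcongr
              norm_num
        _ = _ := by
              generalize (79 / 80 : ℝ) = b
              ring
  have hq' : Q / F.card ≤ 5376000 / K ^ 3 * (79 / 80) ^ (2 * i) := by
    refine le_of_mul_le_mul_left (hq.trans (le_of_eq ?_)) hp0
    rw [hp]; field_simp; ring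
  rwa [div_le_iff₀' hn] at hq'

/-- The scales and signs over which the far neighbours are distributed. -/
def scaleSigns (I : ℕ) : Finset (ℕ × ℝ) := Finset.range I ×ˢ {1, -1}

theorem sum_scaleSigns (I : ℕ) (f : ℕ → ℝ) : ∑ x ∈ scaleSigns I, f x.1 =
    2 * ∑ i ∈ Finset.range I, f i := by
  rw [scaleSigns, Finset.sum_product, Finset.mul_sum]
  refine Finset.sum_congr rfl fun i _ => ?_
  rw [Finset.sum_pair (by norm_num), two_mul]

theorem geom_sum_le_eighty (I : ℕ) : ∑ i ∈ Finset.range I, (79 / 80 : ℝ) ^ i ≤ 80 := by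
  have h := Summable.sum_le_tsum (Finset.range I) (fun i _ => by positivity)
    (summable_geometric_of_lt_one (by norm_num) (by norm_num : (79 / 80 : ℝ) < 1))
  rw [tsum_geometric_of_lt_one (by norm_num) (by norm_num)] at h
  norm_num at h ⊢
  exact h

theorem exists_atScale {t δ D r : ℝ} {I : ℕ} {u w : E3} (ht : 0 ≤ t) (hδ : 0 < δ)
    (hD : 48 * δ ≤ D) (hI : 2 < 2 ^ I * D) (hr : r ∈ Set.Icc (1 / 2 : ℝ) 1)
    (hc : Close t δ r u w) (h1 : D ≤ ‖w - u‖) (h2 : ‖w - u‖ ≤ 2) :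
    ∃ x ∈ scaleSigns I, AtScale (2 ^ x.1 * D) x.2 u w := by
  have hD0 : 0 < D := by linarith
  obtain ⟨i, hi1, hi2⟩ := exists_nat_pow_near ((one_le_div hD0).2 h1) one_lt_two
  rw [le_div_iff₀ hD0] at hi1
  rw [div_lt_iff₀ hD0, pow_succ] at hi2
  have hiI : i < I := by
    have h3 : (2 : ℝ) ^ i * D < 2 ^ I * D := by linarith
    exact (pow_lt_pow_iff_right₀ one_lt_two).1 (lt_of_mul_lt_mul_right h3 hD0.le)
  obtain ⟨e1, e2⟩ := hc.abs_coord_le hδ.le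
  have e1' := e1.trans (show Real.exp (-t) * δ ≤ δ by
    have : Real.exp (-t) ≤ 1 := Real.exp_le_one_iff.2 (by linarith)
    nlinarith)
  have hv : D ^ 2 ≤ (w 0 - u 0) ^ 2 + (w 1 - u 1) ^ 2 + (w 2 - u 2) ^ 2 := by
    rw [← norm_sq_sub_eq]
    exact pow_le_pow_left₀ hD0.le h1 2
  have hz := le_abs_of_close hr hδ (by linarith) hv e1' e2
  rcases lt_trichotomy (w 2 - u 2) 0 with h | h | h
  · refine ⟨(i, -1), ?_, hi1, by linarith, by linarith⟩
    simp [scaleSigns, hiI]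
  · rw [h, abs_zero] at hz
    linarith
  · refine ⟨(i, 1), ?_, hi1, by linarith, by linarith⟩
    simp [scaleSigns, hiI]

theorem mid_or_mem_richSet {F : Finset E3} (hF : (F : Set E3) ⊆ closedBall 0 1) {t δ s D r Θ : ℝ}
    {I : ℕ} {u : E3} (hu : u ∈ F) (ht : 0 ≤ t) (hδ : 0 < δ) (hD : 48 * δ ≤ D)
    (hI : 2 < 2 ^ I * D) (hr : r ∈ Set.Icc (1 / 2 : ℝ) 1) (hΘ : 0 < Θ)
    (hnear : cnt F (fun w => ‖w - u‖ ≤ s) ≤ Θ / 3) (hM : Θ ≤ cnt F (Close t δ r u)) :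
    Θ / 3 ≤ cnt F (fun w => Close t δ r u w ∧ s < ‖w - u‖ ∧ ‖w - u‖ < D) ∨
    ∃ x ∈ scaleSigns I, r ∈ richSet F (Close t δ) (AtScale (2 ^ x.1 * D) x.2) Θ
      ((79 / 80) ^ x.1 / 560) u := by
  by_contra! hcon
  obtain ⟨hmid, hfar⟩ := hcon
  have h1 : cnt F (Close t δ r u) ≤ cnt F (fun w => ‖w - u‖ ≤ s) +
      cnt F (fun w => Close t δ r u w ∧ s < ‖w - u‖) :=
    cnt_le_add F fun w _ hc => (le_or_gt ‖w - u‖ s).imp id fun h => ⟨hc, h⟩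
  have h2 : cnt F (fun w => Close t δ r u w ∧ s < ‖w - u‖) ≤
      cnt F (fun w => Close t δ r u w ∧ s < ‖w - u‖ ∧ ‖w - u‖ < D) +
      cnt F (fun w => Close t δ r u w ∧ D ≤ ‖w - u‖) :=
    cnt_le_add F fun w _ hc => (lt_or_ge ‖w - u‖ D).imp (fun h => ⟨hc.1, hc.2, h⟩)
      fun h => ⟨hc.1, h⟩
  have h3 : cnt F (fun w => Close t δ r u w ∧ D ≤ ‖w - u‖) ≤ ∑ x ∈ scaleSigns I,
      cnt F (fun w => Close t δ r u w ∧ AtScale (2 ^ x.1 * D) x.2 u w) := by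
    refine cnt_le_sum F _ fun w hw hc => ?_
    have n1 : ‖w‖ ≤ 1 := mem_closedBall_zero_iff.1 (hF hw)
    have n2 : ‖u‖ ≤ 1 := mem_closedBall_zero_iff.1 (hF hu)
    obtain ⟨x, hx, hs⟩ := exists_atScale ht hδ hD hI hr hc.1 hc.2
      ((norm_sub_le w u).trans (by linarith))
    exact ⟨x, hx, hc.1, hs⟩
  have h4 : ∑ x ∈ scaleSigns I,
      cnt F (fun w => Close t δ r u w ∧ AtScale (2 ^ x.1 * D) x.2 u w) ≤
      ∑ x ∈ scaleSigns I, (79 / 80) ^ x.1 / 560 * cnt F (Close t δ r u) := by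
    refine Finset.sum_le_sum fun x hx => ?_
    by_contra! hlt
    exact hfar x hx ⟨hM, hlt.le⟩
  rw [← Finset.sum_mul, sum_scaleSigns I fun i => (79 / 80 : ℝ) ^ i / 560,
    ← Finset.sum_div] at h4
  have h5 := geom_sum_le_eighty I
  nlinarith [cnt_nonneg F (Close t δ r u)]

theorem sum_measureReal_le {F : Finset E3} (hF : F.Nonempty)
    (hFb : (F : Set E3) ⊆ closedBall 0 1) {α δ₀ C₀ t δ K : ℝ}
    (hα : 1 ≤ α) (hα' : α ≤ 3 / 2) (hC₀ : 1 ≤ C₀) (ht : 0 ≤ t) (hδ : 0 < δ)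
    (hδ₀ : Real.exp t * δ₀ ≤ δ) (hδ₀' : 0 < δ₀) (hK : 2 ≤ K)
    (hmass : ∀ w : E3, ∀ ρ : ℝ, δ₀ ≤ ρ →
      cnt F (fun w' => ‖w' - w‖ ≤ ρ) ≤ F.card * (C₀ * ρ ^ α)) :
    ∑ u ∈ F, (volume.restrict (Set.Icc (1 / 2 : ℝ) 1)).real
      {r | F.card * (C₀ * Real.exp (-t / 10) * (δ ^ α * K ^ 18)) ≤ cnt F (Close t δ r u)} ≤
      F.card * (10 ^ 9 / K ^ 3) := by
  have hn : 0 < (F.card : ℝ) := by exact_mod_cast hF.card_pos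
  set θ := C₀ * Real.exp (-t / 10) * (δ ^ α * K ^ 18) with hθ
  set D := 20 * K ^ 3 * δ * Real.exp (9 * t / 40) with hDdef
  set s := δ * Real.exp (-t / 10) * K with hs
  set ν := volume.restrict (Set.Icc (1 / 2 : ℝ) 1) with hν
  have hK0 : 0 < K := by linarith
  have hK1 : 1 ≤ K := by linarith
  have hC0 : 0 < C₀ := by linarith
  have hD0 : 0 < D := by positivity
  have hθ0 : 0 < θ := by positivity
  have hs0 : 0 < s := by positivity
  have hK3 : 8 ≤ K ^ 3 := by
    calc (8 : ℝ) = 2 ^ 3 := by norm_num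
      _ ≤ K ^ 3 := by gcongr
  have he : 1 ≤ Real.exp (9 * t / 40) := Real.one_le_exp (by positivity)
  have hD : 48 * δ ≤ D := by
    calc 48 * δ ≤ 20 * 8 * δ * 1 := by linarith
      _ ≤ D := by rw [hDdef]; gcongr
  have hδδ : δ₀ ≤ δ := by
    have : 1 ≤ Real.exp t := Real.one_le_exp ht
    nlinarith
  have hsδ : δ₀ ≤ s := by
    calc δ₀ = 1 * δ₀ * 1 := by ring
      _ ≤ Real.exp (t + -t / 10) * δ₀ * K := by
          gcongr
          exact Real.one_le_exp (by linarith)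
      _ = Real.exp t * δ₀ * Real.exp (-t / 10) * K := by rw [Real.exp_add]; ring
      _ ≤ s := by rw [hs]; gcongr
  have hδα : 0 < δ ^ α := by positivity
  have hnear : ∀ u, cnt F (fun w => ‖w - u‖ ≤ s) ≤ F.card * θ / 3 := by
    intro u
    refine (hmass u s hsδ).trans ?_
    rw [mul_div_assoc]
    refine mul_le_mul_of_nonneg_left ?_ hn.le
    have e1 : s ^ α = δ ^ α * Real.exp (-t / 10) ^ α * K ^ α := by
      rw [hs, Real.mul_rpow (by positivity) hK0.le, Real.mul_rpow hδ.le (Real.exp_pos _).le]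
    have e2 : Real.exp (-t / 10) ^ α ≤ Real.exp (-t / 10) := by
      rw [← Real.exp_mul]
      refine Real.exp_le_exp.2 ?_
      nlinarith
    have e3 : K ^ α ≤ K ^ 2 := by
      rw [← Real.rpow_natCast K 2]
      exact Real.rpow_le_rpow_of_exponent_le hK1 (by push_cast; linarith)
    have e4 : K ^ 2 ≤ K ^ 18 / 3 := by
      have : (2 : ℝ) ^ 16 ≤ K ^ 16 := by gcongr
      have h18 : K ^ 18 = K ^ 16 * K ^ 2 := by ring
      nlinarith [sq_nonneg K]
    calc C₀ * s ^ α ≤ C₀ * (δ ^ α * Real.exp (-t / 10) * (K ^ 18 / 3)) := by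
          rw [e1]; gcongr; exact e3.trans e4
      _ = θ / 3 := by rw [hθ]; ring
  obtain ⟨I, hI⟩ := pow_unbounded_of_one_lt (2 / D) (one_lt_two (α := ℝ))
  rw [div_lt_iff₀ hD0] at hI
  have hmid := sum_measureReal_mid_le (F := F) (t := t) (δ := δ) (s := s) (d := D)
    (ℓ := 24 * Real.exp (-(9 * t / 20))) (θ := θ / 3) (C := C₀ * D ^ α) hF hδ (by positivity)
    (by
      have e : (24 * Real.exp (-(9 * t / 20))) ^ 2 = 576 * Real.exp (-(9 * t / 10)) := by
        rw [mul_pow, ← Real.exp_nat_mul]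
        norm_num
        ring_nf
      rw [e, hs]
      have e2 : Real.exp (-t) = Real.exp (-t / 10) * Real.exp (-(9 * t / 10)) := by
        rw [← Real.exp_add]; ring_nf
      rw [e2]
      calc _ = δ * Real.exp (-t / 10) * 1 * (576 * Real.exp (-(9 * t / 10))) := by ring
        _ ≤ _ := by gcongr)
    fun w _ => hmass w D (by linarith)
  set Mid := ∑ u ∈ F, ν.real {r | F.card * (θ / 3) ≤
    cnt F fun w => Close t δ r u w ∧ s < ‖w - u‖ ∧ ‖w - u‖ < D} with hMid
  have hMidle : Mid ≤ F.card * (28800 / K ^ 3) := by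
    have e1 : D ^ α = (20 * K ^ 3) ^ α * δ ^ α * Real.exp (9 * t / 40) ^ α := by
      rw [hDdef, Real.mul_rpow (by positivity) (Real.exp_pos _).le,
        Real.mul_rpow (by positivity) hδ.le]
    have e2 : (20 * K ^ 3) ^ α ≤ (20 * K ^ 3) ^ 2 := by
      rw [← Real.rpow_natCast (20 * K ^ 3) 2]
      exact Real.rpow_le_rpow_of_exponent_le (by linarith) (by push_cast; linarith)
    have e3 : Real.exp (9 * t / 40) ^ α * Real.exp (-(9 * t / 20)) ≤ Real.exp (-t / 10) := by
      rw [← Real.exp_mul, ← Real.exp_add]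
      refine Real.exp_le_exp.2 ?_
      nlinarith
    have e4 : C₀ * D ^ α * (24 * Real.exp (-(9 * t / 20))) ≤ θ / 3 * (28800 / K ^ 3) := by
      calc _ = 24 * C₀ * δ ^ α * (20 * K ^ 3) ^ α *
            (Real.exp (9 * t / 40) ^ α * Real.exp (-(9 * t / 20))) := by rw [e1]; ring
        _ ≤ 24 * C₀ * δ ^ α * (20 * K ^ 3) ^ 2 * Real.exp (-t / 10) := by gcongr
        _ = 9600 * (C₀ * Real.exp (-t / 10) * δ ^ α) * K ^ 6 := by ring
        _ ≤ 9600 * (C₀ * Real.exp (-t / 10) * δ ^ α) * K ^ 15 := by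
            gcongr
            norm_num
        _ = _ := by rw [hθ]; field_simp; norm_num
    refine le_of_mul_le_mul_left (hmid.trans ?_) (show 0 < θ / 3 by positivity)
    calc _ ≤ F.card * (θ / 3 * (28800 / K ^ 3)) := by gcongr
      _ = _ := by ring
  have hfar : ∀ x ∈ scaleSigns I, ∑ u ∈ F, ν.real (richSet F (Close t δ)
      (AtScale (2 ^ x.1 * D) x.2) (F.card * θ) ((79 / 80) ^ x.1 / 560) u) ≤
      F.card * (5376000 / K ^ 3 * (79 / 80) ^ x.1) := by
    intro x hx
    have hσ : |x.2| = 1 := by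
      rw [scaleSigns, Finset.mem_product] at hx
      rcases Finset.mem_insert.1 hx.2 with h | h
      · rw [h, abs_one]
      · rw [Finset.mem_singleton.1 h, abs_neg, abs_one]
    refine (sum_richSet_le hF x.1 hα' hC₀ ht hδ hδδ hK hσ hmass).trans ?_
    gcongr _ * (_ * ?_)
    exact pow_le_pow_of_le_one (by norm_num) (by norm_num) (by omega)
  have hpt : ∀ u ∈ F, ν.real {r | F.card * θ ≤ cnt F (Close t δ r u)} ≤
      ν.real {r | F.card * (θ / 3) ≤
        cnt F fun w => Close t δ r u w ∧ s < ‖w - u‖ ∧ ‖w - u‖ < D} +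
      ∑ x ∈ scaleSigns I, ν.real (richSet F (Close t δ)
        (AtScale (2 ^ x.1 * D) x.2) (F.card * θ) ((79 / 80) ^ x.1 / 560) u) := by
    intro u hu
    refine le_trans ?_ ((measureReal_union_le _ _).trans
      (add_le_add_right (measureReal_biUnion_finset_le _ _) _))
    refine ENNReal.toReal_mono (measure_ne_top _ _) (measure_mono_ae ?_)
    refine (ae_restrict_iff' measurableSet_Icc).2 (Filter.Eventually.of_forall fun r hr hM => ?_)
    rcases mid_or_mem_richSet hFb hu ht hδ hD hI hr (by positivity) (hnear u) hM with h | h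
    · left
      rw [mul_div_assoc] at h
      exact h
    · right
      simpa using h
  calc _ ≤ Mid + ∑ x ∈ scaleSigns I, ∑ u ∈ F, ν.real (richSet F (Close t δ)
        (AtScale (2 ^ x.1 * D) x.2) (F.card * θ) ((79 / 80) ^ x.1 / 560) u) := by
        rw [Finset.sum_comm, hMid, ← Finset.sum_add_distrib]
        exact Finset.sum_le_sum hpt
    _ ≤ F.card * (28800 / K ^ 3) +
        ∑ x ∈ scaleSigns I, F.card * (5376000 / K ^ 3 * (79 / 80) ^ x.1) :=
        add_le_add hMidle (Finset.sum_le_sum hfar)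
    _ = F.card / K ^ 3 * (28800 + 5376000 * (2 * ∑ i ∈ Finset.range I, (79 / 80) ^ i)) := by
        rw [← sum_scaleSigns, ← Finset.mul_sum, ← Finset.mul_sum]; ring
    _ ≤ F.card / K ^ 3 * 10 ^ 9 := by
        gcongr
        linarith [geom_sum_le_eighty I]
    _ = _ := by ring

theorem stmt2 :
    ∃ η₀ C₁ : ℝ, 0 < η₀ ∧ 1 ≤ C₁ ∧
      ∀ (α δ₀ C₀ : ℝ) (F : Finset E3),
        1 ≤ α → α ≤ 3 / 2 → 0 < δ₀ → δ₀ ≤ 1 → 1 ≤ C₀ → F.Nonempty →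
        (F : Set E3) ⊆ closedBall 0 1 →
        (∀ (w : E3) (δ : ℝ), δ₀ ≤ δ → mass F (closedBall w δ) ≤ C₀ * δ ^ α) →
        ∀ t δ : ℝ, 0 ≤ t → Real.exp t * δ₀ ≤ δ → δ ≤ 1 →
        ∀ η C : ℝ, 0 < η → η ≤ η₀ → C₁ ≤ C →
          mass F {w | w ∈ F ∧
              ENNReal.ofReal (C * δ ^ η) ≤
                volume {r ∈ Set.Icc (1/2 : ℝ) 1 |
                  C₀ * Real.exp (-t / 10) * δ ^ (α - 18 * η) ≤ mDelta F t r δ w}}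
            ≤ C * δ ^ η := by
  refine ⟨1, 10 ^ 5, one_pos, by norm_num, ?_⟩
  intro α δ₀ C₀ F hα hα' hδ₀' _ hC₀ hF hFb hball t δ ht hδ₀ hδ1 η C hη _ hC
  have hδ : 0 < δ := lt_of_lt_of_le (mul_pos (Real.exp_pos t) hδ₀') hδ₀
  have hn : (0 : ℝ) < F.card := by exact_mod_cast hF.card_pos
  have hC0 : 0 < C := by linarith
  set B : E3 → Set ℝ := fun w => {r ∈ Set.Icc (1/2 : ℝ) 1 |
    C₀ * Real.exp (-t / 10) * δ ^ (α - 18 * η) ≤ mDelta F t r δ w} with hB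
  have hBvol : ∀ w, volume (B w) ≤ ENNReal.ofReal (1 / 2) := fun w => by
    refine (measure_mono fun r hr => hr.1).trans ?_
    rw [Real.volume_Icc]
    norm_num
  change mass F {w | w ∈ F ∧ ENNReal.ofReal (C * δ ^ η) ≤ volume (B w)} ≤ C * δ ^ η
  rw [mass_eq_cnt_div]
  set K := δ ^ (-η) with hK
  have hK0 : 0 < K := by positivity
  have hK1 : 1 ≤ K := Real.one_le_rpow_of_pos_of_le_one_of_nonpos hδ hδ1 (by linarith)
  have hδη : δ ^ η = 1 / K := by rw [hK, Real.rpow_neg hδ.le, one_div, inv_inv]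
  have hpow : δ ^ (α - 18 * η) = δ ^ α * K ^ 18 := by
    rw [hK, ← Real.rpow_natCast, ← Real.rpow_mul hδ.le, ← Real.rpow_add hδ]
    congr 1
    push_cast
    ring
  rw [hδη, mul_one_div]
  rcases lt_or_ge (1 / 2) (C / K) with hlarge | hsmall
  · have h0 : cnt F (fun w => w ∈ {w | w ∈ F ∧ ENNReal.ofReal (C / K) ≤ volume (B w)}) = 0 := by
      classical
      rw [cnt_eq_sum]
      refine Finset.sum_eq_zero fun w _ => if_neg fun hw => ?_
      have := (ENNReal.ofReal_le_ofReal_iff (by norm_num)).1 (hw.2.trans (hBvol w))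
      linarith
    rw [h0, zero_div]
    positivity
  have hK2 : 2 ≤ K := by
    rw [div_le_iff₀ hK0] at hsmall
    linarith
  have hmass : ∀ w ρ, δ₀ ≤ ρ → cnt F (fun w' => ‖w' - w‖ ≤ ρ) ≤ F.card * (C₀ * ρ ^ α) := by
    intro w ρ hρ
    have h := hball w ρ hρ
    rw [mass_eq_cnt_div, div_le_iff₀' hn] at h
    simpa only [mem_closedBall, dist_eq_norm] using h
  have hsum := sum_measureReal_le hF hFb hα hα' hC₀ ht hδ hδ₀ hδ₀' hK2 hmass
  have hcnt : cnt F (fun w => w ∈ {w | w ∈ F ∧ ENNReal.ofReal (C / K) ≤ volume (B w)}) * (C / K) ≤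
      F.card * (10 ^ 9 / K ^ 3) := by
    classical
    refine le_trans ?_ hsum
    rw [cnt_eq_sum, Finset.sum_mul]
    refine Finset.sum_le_sum fun u _ => ?_
    split_ifs with hu
    · rw [one_mul]
      have h1 : volume (B u) ≠ ⊤ := ne_top_of_le_ne_top ENNReal.ofReal_ne_top (hBvol u)
      have h2 := (ENNReal.ofReal_le_iff_le_toReal h1).1 hu.2
      refine h2.trans (le_of_eq ?_)
      rw [measureReal_restrict_apply' measurableSet_Icc, Measure.real]
      congr 2
      ext r
      rw [hB, Set.inter_comm]
      refine and_congr_right fun _ => ?_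
      rw [hpow, mDelta, mass_eq_cnt_div, le_div_iff₀' hn]
      rfl
    · rw [zero_mul]
      exact measureReal_nonneg
  have hfin : F.card * (10 ^ 9 / K ^ 3) ≤ C / K * F.card * (C / K) := by
    have e : C / K * F.card * (C / K) = F.card * (C ^ 2 * K / K ^ 3) := by
      field_simp
    rw [e]
    gcongr
    nlinarith
  rw [div_le_iff₀ hn]
  exact le_of_mul_le_mul_right (hcnt.trans hfin) (by positivity)
end
end

section
/- Let 1/2 ≤ β ≤ 1, Ĉ > 0 and 0 < r₀ ≤ 1, and let σ be a Borel probability measure supported on B_{ℝ³}(0,10) satisfying σ(B_{ℝ³}(w,r)) ≤ Ĉ·r^β for all w ∈ ℝ³ and all r ≥ r₀. Then there exist an absolute constant D ≥ 1 and ε₀' > 0 such that for every 0 < ε₀ ≤ ε₀' and every b with r₀ ≤ b ≤ 1 there is a Borel set E_b ⊂ ℝ³ with σ(B_{ℝ³}(0,10) \ E_b) ≤ b^{ε₀}, and for every z ∈ E_b there is a measurable set I_z ⊂ [0,1] with |[0,1] \ I_z| ≤ b^{ε₀}, such that for every r ∈ I_z: σ({z' : |(1, r, r²/2)·(z − z')|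 ≤ b}) ≤ D·Ĉ·b^{49β/100}. -/
open MeasureTheory Real Metric

noncomputable section

/-- A quadratic polynomial that is at most `b` at three `d`-separated points of `[0, 1]` has
coefficients of size `O(b / d ^ 2)`. -/
lemma coeff_sum_mul_sq_le {A B C b d x y w : ℝ} (hd : 0 < d) (hx : 0 ≤ x) (hw : w ≤ 1)
    (hxy : x + d ≤ y) (hyw : y + d ≤ w)
    (hpx : |A + x * B + x ^ 2 / 2 * C| ≤ b) (hpy : |A + y * B + y ^ 2 / 2 * C| ≤ b)
    (hpw : |A + w * B + w ^ 2 / 2 * C| ≤ b) :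
    (|A| + |B| + |C|) * d ^ 2 ≤ 21 * b := by
  have hb : 0 ≤ b := (abs_nonneg _).trans hpx
  have hd1 : d ≤ 1 := by linarith
  have hd2 : d ^ 2 ≤ d := by nlinarith
  have slope {u v : ℝ} (huv : u + d ≤ v) (hu : |A + u * B + u ^ 2 / 2 * C| ≤ b)
      (hv : |A + v * B + v ^ 2 / 2 * C| ≤ b) : |B + (u + v) / 2 * C| * d ≤ 2 * b := by
    calc |B + (u + v) / 2 * C| * d ≤ |B + (u + v) / 2 * C| * |v - u| := by
          gcongr
          exact (by linarith : d ≤ v - u).trans (le_abs_self _)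
      _ = |(A + v * B + v ^ 2 / 2 * C) - (A + u * B + u ^ 2 / 2 * C)| := by
          rw [← abs_mul]; congr 1; ring
      _ ≤ 2 * b := (abs_sub _ _).trans (by linarith)
  have h₁ := slope hxy hpx hpy
  have h₂ := slope hyw hpy hpw
  have hC : |C| * d ^ 2 ≤ 4 * b := by
    calc |C| * d ^ 2 ≤ |C| * |(w - x) / 2| * d := by
          rw [pow_two, ← mul_assoc]
          gcongr
          exact (by linarith : d ≤ (w - x) / 2).trans (le_abs_self _)
      _ = |(B + (y + w) / 2 * C) - (B + (x + y) / 2 * C)| * d := by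
          rw [← abs_mul]; congr 2; ring
      _ ≤ (|B + (y + w) / 2 * C| + |B + (x + y) / 2 * C|) * d := by
          gcongr
          exact abs_sub _ _
      _ ≤ 4 * b := by linarith
  have hB : |B| * d ^ 2 ≤ 6 * b := by
    have hBC : |B| ≤ |B + (x + y) / 2 * C| + |C| := by
      calc |B| = |(B + (x + y) / 2 * C) - (x + y) / 2 * C| := by congr 1; ring
        _ ≤ |B + (x + y) / 2 * C| + |(x + y) / 2 * C| := abs_sub _ _
        _ ≤ _ := by
          rw [abs_mul, abs_of_nonneg (by linarith : 0 ≤ (x + y) / 2)]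
          gcongr
          exact mul_le_of_le_one_left (abs_nonneg _) (by linarith)
    have h₃ : |B + (x + y) / 2 * C| * d ^ 2 ≤ |B + (x + y) / 2 * C| * d := by gcongr
    nlinarith [mul_le_mul_of_nonneg_right hBC (sq_nonneg d)]
  have hA : |A| * d ^ 2 ≤ 11 * b := by
    have hABC : |A| ≤ b + |B| + |C| := by
      calc |A| = |(A + x * B + x ^ 2 / 2 * C) - x * B - x ^ 2 / 2 * C| := by congr 1; ring
        _ ≤ |A + x * B + x ^ 2 / 2 * C| + |x * B| + |x ^ 2 / 2 * C| :=
          (abs_sub _ _).trans (by gcongr; exact abs_sub _ _)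
        _ ≤ _ := by
          rw [abs_mul, abs_mul, abs_of_nonneg hx, abs_of_nonneg (by positivity : 0 ≤ x ^ 2 / 2)]
          gcongr
          · exact mul_le_of_le_one_left (abs_nonneg _) (by linarith)
          · exact mul_le_of_le_one_left (abs_nonneg _) (by nlinarith)
    have h₄ : b * d ^ 2 ≤ b := mul_le_of_le_one_right hb (by linarith)
    nlinarith [mul_le_mul_of_nonneg_right hABC (sq_nonneg d)]
  linarith

lemma volume_quadratic_sublevel_le {A B C b d : ℝ} (hd : 0 < d)
    (h : 21 * b < (|A| + |B| + |C|) * d ^ 2) :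
    volume {r | r ∈ Set.Icc (0 : ℝ) 1 ∧ |A + r * B + r ^ 2 / 2 * C| ≤ b} ≤
      ENNReal.ofReal (2 * d) := by
  set S := {r | r ∈ Set.Icc (0 : ℝ) 1 ∧ |A + r * B + r ^ 2 / 2 * C| ≤ b}
  rcases S.eq_empty_or_nonempty with hS | hS
  · simp [hS]
  have hle : IsClosed {r : ℝ | |A + r * B + r ^ 2 / 2 * C| ≤ b} :=
    isClosed_le (by fun_prop) continuous_const
  have hclosed : IsClosed S := isClosed_Icc.inter hle
  have hcompact : IsCompact S := isCompact_Icc.of_isClosed_subset hclosed fun r hr => hr.1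
  obtain ⟨x, hxS, hx⟩ := hcompact.exists_isLeast hS
  obtain ⟨w, hwS, hw⟩ := hcompact.exists_isGreatest hS
  have hsub : S ⊆ Set.Icc x (x + d) ∪ Set.Icc (w - d) w := by
    intro y hyS
    by_contra hy
    simp only [Set.mem_union, Set.mem_Icc, not_or, not_and, not_le] at hy
    have hxy := hy.1 (hx hyS)
    have hyw : y < w - d := by
      by_contra! hle
      exact (hy.2 hle).not_ge (hw hyS)
    exact h.not_ge (coeff_sum_mul_sq_le hd hxS.1.1 hwS.1.2 hxy.le (by linarith)
      hxS.2 hyS.2 hwS.2)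
  calc volume S ≤ volume (Set.Icc x (x + d)) + volume (Set.Icc (w - d) w) :=
        (measure_mono hsub).trans (measure_union_le _ _)
    _ = ENNReal.ofReal (2 * d) := by
        rw [Real.volume_Icc, Real.volume_Icc, ← ENNReal.ofReal_add (by linarith) (by linarith)]
        congr 1; ring

lemma E3.norm_le_sum_abs (v : E3) : ‖v‖ ≤ |v 0| + |v 1| + |v 2| := by
  rw [EuclideanSpace.norm_eq]
  refine Real.sqrt_le_iff.2 ⟨by positivity, ?_⟩
  simp only [Fin.sum_univ_three, Real.norm_eq_abs]
  nlinarith [mul_nonneg (abs_nonneg (v 0)) (abs_nonneg (v 1)),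
    mul_nonneg (abs_nonneg (v 0)) (abs_nonneg (v 2)),
    mul_nonneg (abs_nonneg (v 1)) (abs_nonneg (v 2))]

/-- The directions along which `z` and `z'` have projections within `b` of each other form a set
whose measure is dominated by a sum over the balls `closedBall z (4 ^ j * b)` containing `z'`. -/
lemma volume_projection_le_tsum (z z' : E3) {b : ℝ} (hb : 0 < b) :
    volume {r | r ∈ Set.Icc (0 : ℝ) 1 ∧
      |(z 0 - z' 0) + r * (z 1 - z' 1) + r ^ 2 / 2 * (z 2 - z' 2)| ≤ b} ≤
    ∑' j : ℕ, (closedBall z (4 ^ j * b)).indicator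
      (fun _ => ENNReal.ofReal (20 * (1 / 2) ^ j)) z' := by
  have hex : ∃ j : ℕ, dist z' z ≤ 4 ^ j * b := by
    obtain ⟨j, hj⟩ := pow_unbounded_of_one_lt (dist z' z / b) (by norm_num : (1 : ℝ) < 4)
    exact ⟨j, ((div_lt_iff₀ hb).1 hj).le⟩
  classical
  set j := Nat.find hex with hj
  have hjs : dist z' z ≤ 4 ^ j * b := Nat.find_spec hex
  refine le_trans ?_ (ENNReal.le_tsum j)
  rw [Set.indicator_of_mem (mem_closedBall.2 hjs)]
  rcases Nat.eq_zero_or_pos j with h0 | hpos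
  · rw [h0]
    calc _ ≤ volume (Set.Icc (0 : ℝ) 1) := measure_mono fun r hr => hr.1
      _ ≤ _ := by
        rw [Real.volume_Icc]
        exact ENNReal.ofReal_le_ofReal (by norm_num)
  · obtain ⟨k, hk⟩ : ∃ k, j = k + 1 := ⟨j - 1, by omega⟩
    have hfar : 4 ^ k * b < dist z' z := not_le.1 (Nat.find_min hex (by omega : k < j))
    have hnorm : 4 ^ k * b < |z 0 - z' 0| + |z 1 - z' 1| + |z 2 - z' 2| := by
      rw [dist_comm, dist_eq_norm] at hfar
      exact hfar.trans_le (by simpa using E3.norm_le_sum_abs (z - z'))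
    have hscale : (4 : ℝ) ^ k * ((1 / 2) ^ k) ^ 2 = 1 := by
      rw [← pow_mul, mul_comm k 2, pow_mul, ← mul_pow]; norm_num
    refine (volume_quadratic_sublevel_le (d := 10 * (1 / 2) ^ j) (by positivity) ?_).trans_eq
      (by congr 1; ring)
    calc 21 * b < 25 * b := by linarith
      _ = (4 ^ k * b) * (10 * (1 / 2) ^ j) ^ 2 := by
        rw [hk, pow_succ]; linear_combination (-25 * b) * hscale
      _ ≤ _ := by gcongr

lemma four_rpow_div_two_lt_one : (4 : ℝ) ^ (99 / 200 : ℝ) / 2 < 1 := by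
  have h : (4 : ℝ) ^ (99 / 200 : ℝ) < 4 ^ (1 / 2 : ℝ) :=
    Real.rpow_lt_rpow_of_exponent_lt (by norm_num) (by norm_num)
  have h2 : (4 : ℝ) ^ (1 / 2 : ℝ) = 2 := by
    rw [← Real.sqrt_eq_rpow, show (4 : ℝ) = 2 ^ 2 by norm_num, Real.sqrt_sq (by norm_num)]
  linarith

/-- The average of the concentration of the projections of `σ` around the projection of `z`. -/
lemma lintegral_measure_projection_le {β Chat r₀ b : ℝ} {σ : Measure E3} [IsProbabilityMeasure σ]
    (hβ : 0 ≤ β) (hβ1 : β ≤ 1) (hr₀ : r₀ ≤ 1)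
    (hsupp : σ (closedBall (0 : E3) 10)ᶜ = 0)
    (hσ : ∀ (w : E3) (r : ℝ), r₀ ≤ r → σ (closedBall w r) ≤ ENNReal.ofReal (Chat * r ^ β))
    (hChat : 0 < Chat) (hb : 0 < b) (hrb : r₀ ≤ b) (z : E3) :
    ∫⁻ r in Set.Icc (0 : ℝ) 1,
      σ {z' | |(z 0 - z' 0) + r * (z 1 - z' 1) + r ^ 2 / 2 * (z 2 - z' 2)| ≤ b} ≤
    ENNReal.ofReal (200 / (1 - (4 : ℝ) ^ (99 / 200 : ℝ) / 2) * Chat * b ^ (99 * β / 200)) := by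
  have hC10 : 1 ≤ 10 * Chat := by
    have h1 : σ (closedBall (0 : E3) 10) = 1 := (prob_compl_eq_zero_iff
      isClosed_closedBall.measurableSet).1 hsupp
    have h2 := hσ 0 10 (by linarith)
    rw [h1, ENNReal.one_le_ofReal] at h2
    have h3 : (10 : ℝ) ^ β ≤ 10 := by
      simpa using Real.rpow_le_rpow_of_exponent_le (by norm_num : (1 : ℝ) ≤ 10) hβ1
    nlinarith
  have hball (j : ℕ) : σ (closedBall z (4 ^ j * b)) ≤
      ENNReal.ofReal (10 * Chat * (4 ^ j * b) ^ (99 * β / 200)) := by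
    rcases le_total 1 ((4 : ℝ) ^ j * b) with h | h
    · refine prob_le_one.trans (ENNReal.one_le_ofReal.2 ?_)
      exact one_le_mul_of_one_le_of_one_le hC10 (Real.one_le_rpow h (by positivity))
    · refine (hσ z _ (hrb.trans (le_mul_of_one_le_left hb.le
        (one_le_pow₀ (by norm_num))))).trans (ENNReal.ofReal_le_ofReal ?_)
      have := Real.rpow_le_rpow_of_exponent_ge (by positivity) h
        (by linarith : 99 * β / 200 ≤ β)
      gcongr
      linarith
  set q : ℝ := (4 : ℝ) ^ (99 / 200 : ℝ) / 2 with hq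
  have hq0 : 0 ≤ q := by positivity
  have hq1 : q < 1 := four_rpow_div_two_lt_one
  have hterm (j : ℕ) : ENNReal.ofReal (20 * (1 / 2) ^ j) * σ (closedBall z (4 ^ j * b)) ≤
      ENNReal.ofReal (200 * Chat * b ^ (99 * β / 200) * q ^ j) := by
    refine (mul_le_mul_right (hball j) _).trans ?_
    rw [← ENNReal.ofReal_mul (by positivity)]
    refine ENNReal.ofReal_le_ofReal ?_
    have hpow : ((4 : ℝ) ^ j) ^ (99 * β / 200) ≤ ((4 : ℝ) ^ (99 / 200 : ℝ)) ^ j := by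
      rw [← Real.rpow_pow_comm (by norm_num)]
      gcongr
      · norm_num
      · linarith
    rw [Real.mul_rpow (by positivity) hb.le]
    calc _ = 200 * Chat * b ^ (99 * β / 200) * ((1 / 2) ^ j * (4 ^ j) ^ (99 * β / 200)) := by ring
      _ ≤ 200 * Chat * b ^ (99 * β / 200) * ((1 / 2) ^ j * ((4 : ℝ) ^ (99 / 200 : ℝ)) ^ j) := by
        gcongr
      _ = _ := by rw [← mul_pow, hq]; congr 2; ring
  set P : Set (ℝ × E3) :=
    {p | |(z 0 - p.2 0) + p.1 * (z 1 - p.2 1) + p.1 ^ 2 / 2 * (z 2 - p.2 2)| ≤ b}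
  have hP : MeasurableSet P :=
    (isClosed_le (by fun_prop) continuous_const).measurableSet
  calc _ = ((volume.restrict (Set.Icc (0 : ℝ) 1)).prod σ) P := (Measure.prod_apply hP).symm
    _ = ∫⁻ z', volume {r | r ∈ Set.Icc (0 : ℝ) 1 ∧
          |(z 0 - z' 0) + r * (z 1 - z' 1) + r ^ 2 / 2 * (z 2 - z' 2)| ≤ b} ∂σ := by
        rw [Measure.prod_apply_symm hP]
        refine lintegral_congr fun z' => ?_
        rw [Measure.restrict_apply (measurable_prodMk_right hP), Set.inter_comm]
        rfl
    _ ≤ ∫⁻ z', ∑' j : ℕ, (closedBall z (4 ^ j * b)).indicator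
          (fun _ => ENNReal.ofReal (20 * (1 / 2) ^ j)) z' ∂σ :=
        lintegral_mono fun z' => volume_projection_le_tsum z z' hb
    _ = ∑' j : ℕ, ENNReal.ofReal (20 * (1 / 2) ^ j) * σ (closedBall z (4 ^ j * b)) := by
        rw [lintegral_tsum fun j => (measurable_const.indicator
          isClosed_closedBall.measurableSet).aemeasurable]
        exact tsum_congr fun j => lintegral_indicator_const isClosed_closedBall.measurableSet _
    _ ≤ ∑' j : ℕ, ENNReal.ofReal (200 * Chat * b ^ (99 * β / 200) * q ^ j) :=
        ENNReal.tsum_le_tsum hterm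
    _ = ENNReal.ofReal (∑' j : ℕ, 200 * Chat * b ^ (99 * β / 200) * q ^ j) :=
        (ENNReal.ofReal_tsum_of_nonneg (fun j => by positivity)
          ((summable_geometric_of_lt_one hq0 hq1).mul_left _)).symm
    _ = _ := by
        rw [tsum_mul_left, tsum_geometric_of_lt_one hq0 hq1]
        congr 1; ring


theorem stmt3 :
    ∃ D ε₀' : ℝ, 1 ≤ D ∧ 0 < ε₀' ∧
      ∀ (β Chat r₀ : ℝ) (σ : Measure E3), 1/2 ≤ β → β ≤ 1 → 0 < Chat → 0 < r₀ → r₀ ≤ 1 →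
        IsProbabilityMeasure σ → σ (closedBall (0 : E3) 10)ᶜ = 0 →
        (∀ (w : E3) (r : ℝ), r₀ ≤ r → σ (closedBall w r) ≤ ENNReal.ofReal (Chat * r ^ β)) →
        ∀ ε₀ : ℝ, 0 < ε₀ → ε₀ ≤ ε₀' →
        ∀ b : ℝ, r₀ ≤ b → b ≤ 1 →
          ∃ E : Set E3, MeasurableSet E ∧
            σ (closedBall (0 : E3) 10 \ E) ≤ ENNReal.ofReal (b ^ ε₀) ∧
            ∀ z ∈ E, ∃ I : Set ℝ, MeasurableSet I ∧ I ⊆ Set.Icc 0 1 ∧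
              volume (Set.Icc (0 : ℝ) 1 \ I) ≤ ENNReal.ofReal (b ^ ε₀) ∧
              ∀ r ∈ I,
                σ {z' | |(z 0 - z' 0) + r * (z 1 - z' 1) + r ^ 2 / 2 * (z 2 - z' 2)| ≤ b} ≤
                  ENNReal.ofReal (D * Chat * b ^ (49 * β / 100)) := by
  have hq := four_rpow_div_two_lt_one
  have hq0 : (0 : ℝ) < (4 : ℝ) ^ (99 / 200 : ℝ) / 2 := by positivity
  have hD : 1 ≤ 200 / (1 - (4 : ℝ) ^ (99 / 200 : ℝ) / 2) := by
    rw [one_le_div (by linarith)]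
    linarith
  refine ⟨200 / (1 - (4 : ℝ) ^ (99 / 200 : ℝ) / 2), 1 / 400, hD, by norm_num, ?_⟩
  intro β Chat r₀ σ hβ hβ1 hChat hr₀ hr₀1 _ hsupp hσ ε₀ _ hε₀' b hrb hb1
  have hb : 0 < b := hr₀.trans_le hrb
  refine ⟨Set.univ, MeasurableSet.univ, by simp, fun z _ => ?_⟩
  have hint := lintegral_measure_projection_le (by linarith) hβ1 hr₀1 hsupp hσ hChat hb hrb z
  set D := 200 / (1 - (4 : ℝ) ^ (99 / 200 : ℝ) / 2)
  set f : ℝ → ENNReal := fun r =>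
    σ {z' | |(z 0 - z' 0) + r * (z 1 - z' 1) + r ^ 2 / 2 * (z 2 - z' 2)| ≤ b}
  have hf : Measurable f := by
    have hP : MeasurableSet {p : ℝ × E3 |
        |(z 0 - p.2 0) + p.1 * (z 1 - p.2 1) + p.1 ^ 2 / 2 * (z 2 - p.2 2)| ≤ b} :=
      (isClosed_le (by fun_prop) continuous_const).measurableSet
    exact measurable_measure_prodMk_left hP
  set c : ℝ := D * Chat * b ^ (49 * β / 100)
  have hc : 0 < c := by positivity
  refine ⟨Set.Icc 0 1 ∩ {r | f r ≤ ENNReal.ofReal c},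
    measurableSet_Icc.inter (measurableSet_le hf measurable_const),
    Set.inter_subset_left, ?_, fun r hr => hr.2⟩
  have hbad : volume (Set.Icc (0 : ℝ) 1 \ (Set.Icc 0 1 ∩ {r | f r ≤ ENNReal.ofReal c})) ≤
      volume.restrict (Set.Icc (0 : ℝ) 1) {r | ENNReal.ofReal c ≤ f r} := by
    rw [Measure.restrict_apply (measurableSet_le measurable_const hf)]
    exact measure_mono fun r hr =>
      ⟨(not_le.1 fun h : f r ≤ ENNReal.ofReal c => hr.2 ⟨hr.1, h⟩).le, hr.1⟩
  refine hbad.trans ((meas_ge_le_lintegral_div hf.aemeasurable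
    (ENNReal.ofReal_pos.2 hc).ne' ENNReal.ofReal_ne_top).trans ?_)
  rw [ENNReal.div_le_iff (ENNReal.ofReal_pos.2 hc).ne' ENNReal.ofReal_ne_top,
    ← ENNReal.ofReal_mul (by positivity)]
  refine hint.trans (ENNReal.ofReal_le_ofReal ?_)
  calc D * Chat * b ^ (99 * β / 200) ≤ D * Chat * b ^ (ε₀ + 49 * β / 100) := by
        gcongr ?_ * ?_
        exact Real.rpow_le_rpow_of_exponent_ge hb hb1 (by linarith)
    _ = b ^ ε₀ * c := by rw [Real.rpow_add hb]; ring
end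
end
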